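/- arXiv:0901.2358 — 2 statements merged into one kernel-verified Lean document; each statement's English description precedes it below -/
import Mathlib

section
/- Let f, h be real Schwartz functions on ℝ³, fix t₀ > 0, and set ψ = K_{t₀}(f,h). Then the function u(t,x⃗) = (2π)^{−3/2}·∫_{ℝ³} e^{i k⃗·x⃗}·[v(t,|k⃗|)·ψ(k⃗) + conj(v(t,|k⃗|))·conj(ψ(−k⃗))] dk⃗ is infinitely differentiable (C^∞) on (0,∞)×ℝ³. -/
open Complex MeasureTheory Filter
open scoped RealInnerProductSpace

noncomputable section

/-- Three-dimensional Euclidean space. -/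
abbrev V3 : Type := EuclideanSpace ℝ (Fin 3)

/-- The Bessel function of complex order `α`:
`J_α(x) = Σ_{n=0}^∞ ((−1)^n/(n!·Γ(α+n+1)))·exp((α+2n)·log(x/2))`. -/
def besselJ (α : ℂ) (x : ℝ) : ℂ :=
  ∑' n : ℕ, ((-1 : ℂ) ^ n / ((n.factorial : ℂ) * Complex.Gamma (α + (n : ℂ) + 1))) *
    Complex.exp ((α + 2 * (n : ℂ)) * (Real.log (x / 2) : ℂ))

/-- The Hankel function of the first kind. -/
def hankel1 (α : ℂ) (x : ℝ) : ℂ :=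
  (besselJ (-α) x - Complex.exp (-(Complex.I * (Real.pi : ℂ) * α)) * besselJ α x) /
    (Complex.I * Complex.sin (α * (Real.pi : ℂ)))

/-- The Hankel function of the second kind. -/
def hankel2 (α : ℂ) (x : ℝ) : ℂ :=
  (Complex.exp (Complex.I * (Real.pi : ℂ) * α) * besselJ α x - besselJ (-α) x) /
    (Complex.I * Complex.sin (α * (Real.pi : ℂ)))

/-- `μ = √((mR)² − 9/4)`. -/
def modeMu (m R : ℝ) : ℝ := Real.sqrt ((m * R) ^ 2 - 9 / 4)

/-- `ν = iμ`. -/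
def modeNu (m R : ℝ) : ℂ := Complex.I * (modeMu m R : ℂ)

/-- The mode function `v(t,k) = e^{−μπ/2}·t^{3/2}·H^{(1)}_ν(kt)`. -/
def modeV (m R t k : ℝ) : ℂ :=
  (Real.exp (-(modeMu m R * Real.pi / 2)) : ℂ) * ((t ^ ((3 : ℝ) / 2) : ℝ) : ℂ) *
    hankel1 (modeNu m R) (k * t)

/-- `v′(t,k) = ∂v/∂t (t,k)`. -/
def modeV' (m R t k : ℝ) : ℂ := deriv (fun s => modeV m R s k) t

/-- `ω(k) = √(1+k²)`. -/
def omegaK (k : ℝ) : ℝ := Real.sqrt (1 + k ^ 2)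

/-- The Fourier transform on `ℝ³`. -/
def ft (g : V3 → ℂ) (k : V3) : ℂ :=
  (((2 * Real.pi) ^ (-(3 : ℝ) / 2) : ℝ) : ℂ) *
    ∫ x : V3, Complex.exp (-(Complex.I) * (⟪k, x⟫ : ℂ)) * g x

/-- The inverse Fourier transform on `ℝ³`. -/
def ift (g : V3 → ℂ) (x : V3) : ℂ :=
  (((2 * Real.pi) ^ (-(3 : ℝ) / 2) : ℝ) : ℂ) *
    ∫ k : V3, Complex.exp (Complex.I * (⟪k, x⟫ : ℂ)) * g k

/-- The map `K_t` on the Fourier side, applied to the Fourier transforms `f̃, h̃`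
of the Cauchy data:
`K_t(f,h)(k) = (πi/(4t³))·[t·f̃(k)·conj(v′(t,|k|)) − R·h̃(k)·conj(v(t,|k|))]`. -/
def ktAux (m R t : ℝ) (ftil htil : V3 → ℂ) (k : V3) : ℂ :=
  ((Real.pi : ℂ) * Complex.I / (4 * (t : ℂ) ^ 3)) *
    ((t : ℂ) * ftil k * (starRingEnd ℂ) (modeV' m R t ‖k‖) -
      (R : ℂ) * htil k * (starRingEnd ℂ) (modeV m R t ‖k‖))

/-- `K_t` applied to real Cauchy data `(f,h)`. -/
def ktFun (m R t : ℝ) (f h : V3 → ℝ) : V3 → ℂ :=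
  ktAux m R t (ft fun x => (f x : ℂ)) (ft fun x => (h x : ℂ))

/-- The Fourier transform of the first component of the pair `L_tψ`:
`f̃_t(k) = v(t,|k|)·ψ(k) + conj(v(t,|k|))·conj(ψ(−k))`. -/
def ltF (m R t : ℝ) (ψ : V3 → ℂ) (k : V3) : ℂ :=
  modeV m R t ‖k‖ * ψ k + (starRingEnd ℂ) (modeV m R t ‖k‖) * (starRingEnd ℂ) (ψ (-k))

/-- The Fourier transform of the second component of the pair `L_tψ`:
`h̃_t(k) = (t/R)·[v′(t,|k|)·ψ(k) + conj(v′(t,|k|))·conj(ψ(−k))]`. -/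
def ltH (m R t : ℝ) (ψ : V3 → ℂ) (k : V3) : ℂ :=
  ((t / R : ℝ) : ℂ) *
    (modeV' m R t ‖k‖ * ψ k + (starRingEnd ℂ) (modeV' m R t ‖k‖) * (starRingEnd ℂ) (ψ (-k)))

/-- The solution `u(t,x⃗)` built from the coefficient function `ψ`:
`u(t,x⃗) = (2π)^{−3/2}·∫ e^{ik⃗·x⃗}·[v(t,|k⃗|)·ψ(k⃗) + conj(v(t,|k⃗|))·conj(ψ(−k⃗))] dk⃗`. -/
def uSol (m R : ℝ) (ψ : V3 → ℂ) (t : ℝ) (x : V3) : ℂ :=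
  (((2 * Real.pi) ^ (-(3 : ℝ) / 2) : ℝ) : ℂ) *
    ∫ k : V3, Complex.exp (Complex.I * (⟪k, x⟫ : ℂ)) *
      (modeV m R t ‖k‖ * ψ k + (starRingEnd ℂ) (modeV m R t ‖k‖) * (starRingEnd ℂ) (ψ (-k)))

/-- The spatial Laplacian, as the sum of the second partial derivatives along
the coordinate directions. -/
def lap3 (w : V3 → ℂ) (x : V3) : ℂ :=
  ∑ i : Fin 3, iteratedDeriv 2 (fun s : ℝ => w (x + s • EuclideanSpace.single i (1 : ℝ))) 0

/-- The square of the Sobolev-type norm `‖(f,h)‖_{1/2}`, expressed in terms of the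
Fourier transforms `f̃, h̃` of the data:
`‖(f,h)‖_{1/2}² = ∫ ω(|k⃗|)·|f̃(k⃗)|² dk⃗ + ∫ ω(|k⃗|)⁻¹·|h̃(k⃗)|² dk⃗`. -/
def halfNormSq (ftil htil : V3 → ℂ) : ℝ :=
  (∫ k : V3, omegaK ‖k‖ * ‖ftil k‖ ^ 2) + ∫ k : V3, (omegaK ‖k‖)⁻¹ * ‖htil k‖ ^ 2

/-- The Sobolev-type norm `‖(f,h)‖_{1/2}` (arguments are the Fourier transforms). -/
def halfNorm (ftil htil : V3 → ℂ) : ℝ := Real.sqrt (halfNormSq ftil htil)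

/-- The `L²(ℝ³)` norm. -/
def l2Norm (g : V3 → ℂ) : ℝ := Real.sqrt (∫ k : V3, ‖g k‖ ^ 2)

/-- The transformed potential operator `V̂` with (Fourier-transformed) potential `W`:
`(V̂ψ)(k⃗) = −(2π)^{3/2}·R·(πi/4)·conj(v(1,|k⃗|))·(W ∗ g_ψ)(k⃗)` where
`g_ψ(k⃗) = v(1,|k⃗|)·ψ(k⃗) + conj(v(1,|k⃗|))·conj(ψ(−k⃗))`. -/
def vHatOp (m R : ℝ) (W : V3 → ℂ) (ψ : V3 → ℂ) (k : V3) : ℂ :=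
  ((-((2 * Real.pi) ^ ((3 : ℝ) / 2)) * R : ℝ) : ℂ) * ((Real.pi : ℂ) * Complex.I / 4) *
    (starRingEnd ℂ) (modeV m R 1 ‖k‖) * ∫ y : V3, W y * ltF m R 1 ψ (k - y)

/-- The free transformed evolution `Û₀(a,b) = K₁ ∘ L_a ∘ K_b ∘ L₁` on `L²(ℝ³)`. -/
def u0Hat (m R a b : ℝ) (ψ : V3 → ℂ) : V3 → ℂ :=
  ktAux m R 1 (ltF m R a (ktAux m R b (ltF m R 1 ψ) (ltH m R 1 ψ)))
    (ltH m R a (ktAux m R b (ltF m R 1 ψ) (ltH m R 1 ψ)))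

/-- The inner chain `V̂(s)·V̂(s₂)···V̂(s_{j+1})·Û₀(s_{j+1},1)ψ` of the `n`-th Dyson term,
with the nested integrals `∫₁^{s}···` built in; `W s` is the spatial Fourier transform
of the potential at time `s`. -/
def dysonM (m R : ℝ) (W : ℝ → V3 → ℂ) : ℕ → ℝ → (V3 → ℂ) → V3 → ℂ
  | 0, s, ψ => vHatOp m R (W s) (u0Hat m R s 1 ψ)
  | j + 1, s, ψ => vHatOp m R (W s) fun k => ∫ r in Set.Ioc (1 : ℝ) s, dysonM m R W j r ψ k

/-- The `n`-th Dyson term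
`∫₁^t∫₁^{s₁}···∫₁^{s_{n−1}} Û₀(t,s₁)·V̂(s₁)···V̂(s_n)·Û₀(s_n,1)ψ ds_n···ds₁` (for `n ≥ 1`). -/
def dysonT (m R : ℝ) (W : ℝ → V3 → ℂ) (n : ℕ) (t : ℝ) (ψ : V3 → ℂ) : V3 → ℂ := fun k =>
  ∫ s in Set.Ioc (1 : ℝ) t, u0Hat m R t s (dysonM m R W (n - 1) s ψ) k

/-- Rapidly decaying coefficient sequences. -/
def RapidSeq (d : ℕ → ℂ) : Prop := ∀ r : ℝ, 0 ≤ r → Summable fun n => ‖d n‖ * r ^ n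

/-- The exponential series attached to a coefficient sequence. -/
def expSer (α : ℂ) (d : ℕ → ℂ) (y : ℝ) : ℂ :=
  ∑' n : ℕ, d n * Complex.exp ((α + 2 * (n : ℂ)) * (y : ℂ))

theorem RapidSeq.mulLin {d : ℕ → ℂ} (hd : RapidSeq d) (α : ℂ) :
    RapidSeq fun n => d n * (α + 2 * (n : ℂ)) := by
  intro r hr
  have h1 := (hd (2 * r) (by positivity)).mul_left (‖α‖ + 2)
  refine Summable.of_nonneg_of_le (fun n => by positivity) (fun n => ?_) h1
  have h2 : ‖α + 2 * (n : ℂ)‖ ≤ (‖α‖ + 2) * 2 ^ n := by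
    have h3 : ‖α + 2 * (n : ℂ)‖ ≤ ‖α‖ + 2 * n := by
      refine (norm_add_le _ _).trans ?_
      simp
    have h4 : (n : ℝ) ≤ 2 ^ n := by exact_mod_cast (Nat.lt_two_pow_self (n := n)).le
    have h5 : (1 : ℝ) ≤ 2 ^ n := one_le_pow₀ (by norm_num)
    nlinarith [norm_nonneg α]
  rw [norm_mul, mul_pow]
  have : 0 ≤ ‖d n‖ * r ^ n := by positivity
  nlinarith

theorem expSer_bound {α : ℂ} (d : ℂ) (n : ℕ) {y b : ℝ} (hy : |y| ≤ b) :
    ‖d * Complex.exp ((α + 2 * (n : ℂ)) * (y : ℂ))‖ ≤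
      Real.exp (‖α‖ * b) * (‖d‖ * (Real.exp (2 * b)) ^ n) := by
  have h0 : Real.exp (2 * b) ^ n = Real.exp (2 * n * b) := by
    rw [← Real.exp_nat_mul]; congr 1; ring
  rw [h0, norm_mul, Complex.norm_exp]
  have h1 : ((α + 2 * (n : ℂ)) * (y : ℂ)).re = (α.re + 2 * n) * y := by
    simp [Complex.mul_re]
  rw [h1]
  have h2 : (α.re + 2 * n) * y ≤ ‖α‖ * b + 2 * n * b := by
    have h3 : α.re * y ≤ ‖α‖ * b := by
      refine (le_abs_self _).trans ?_
      rw [abs_mul]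
      exact mul_le_mul (Complex.abs_re_le_norm α) hy (abs_nonneg _) (norm_nonneg _)
    have h4 : 2 * n * y ≤ 2 * n * b :=
      mul_le_mul_of_nonneg_left ((le_abs_self _).trans hy) (by positivity)
    linarith
  have h3 := Real.exp_le_exp.2 h2
  rw [Real.exp_add] at h3
  have := mul_le_mul_of_nonneg_left h3 (norm_nonneg d)
  linarith

theorem expSer_summable {d : ℕ → ℂ} (hd : RapidSeq d) (α : ℂ) (y : ℝ) :
    Summable fun n : ℕ => d n * Complex.exp ((α + 2 * (n : ℂ)) * (y : ℂ)) :=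
  Summable.of_norm_bounded ((hd (Real.exp (2 * |y|)) (Real.exp_pos _).le).mul_left
    (Real.exp (‖α‖ * |y|))) fun n => expSer_bound (d n) n le_rfl

theorem expSer_hasDerivAt {d : ℕ → ℂ} (hd : RapidSeq d) (α : ℂ) (y : ℝ) :
    HasDerivAt (expSer α d) (expSer α (fun n => d n * (α + 2 * (n : ℂ))) y) y := by
  have hy : y ∈ Metric.ball (0 : ℝ) (|y| + 1) := by simp
  have hS := expSer_summable hd α y
  unfold expSer
  refine hasDerivAt_tsum_of_isPreconnected (𝕜 := ℝ)
    (g := fun (n : ℕ) (z : ℝ) => d n * Complex.exp ((α + 2 * (n : ℂ)) * (z : ℂ)))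
    (g' := fun (n : ℕ) (z : ℝ) =>
      d n * (α + 2 * (n : ℂ)) * Complex.exp ((α + 2 * (n : ℂ)) * (z : ℂ)))
    (t := Metric.ball (0 : ℝ) (|y| + 1)) (y₀ := y)
    (u := fun n => Real.exp (‖α‖ * (|y| + 1)) *
      (‖d n * (α + 2 * (n : ℂ))‖ * (Real.exp (2 * (|y| + 1))) ^ n))
    (((hd.mulLin α) _ (Real.exp_pos _).le).mul_left _)
    Metric.isOpen_ball (convex_ball _ _).isPreconnected
    (fun n z hz => ?_) (fun n z hz => ?_) hy hS hy
  · have h1 : HasDerivAt (fun z : ℝ => (α + 2 * (n : ℂ)) * (z : ℂ)) (α + 2 * (n : ℂ)) z := by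
      simpa using (Complex.ofRealCLM.hasDerivAt (x := z)).const_mul (α + 2 * (n : ℂ))
    have h2 := (h1.cexp).const_mul (d n)
    exact h2.congr_deriv (by ring)
  · refine expSer_bound _ n ?_
    simp at hz
    exact hz.le

/-- Coefficients of the Bessel series. -/
def besC (α : ℂ) (n : ℕ) : ℂ :=
  (-1 : ℂ) ^ n / ((n.factorial : ℂ) * Complex.Gamma (α + (n : ℂ) + 1))

theorem imag_ne {α : ℂ} (hα : α.re = 0) (n : ℕ) : α + (n : ℂ) + 1 ≠ 0 := by
  intro h
  have := congrArg Complex.re h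
  simp [hα] at this
  have h2 : (0 : ℝ) ≤ n := by positivity
  linarith

theorem besC_rec {α : ℂ} (hα : α.re = 0) (n : ℕ) :
    besC α (n + 1) * (((n : ℂ) + 1) * (α + (n : ℂ) + 1)) = - besC α n := by
  have h1 := imag_ne hα n
  have hG : Complex.Gamma (α + (n : ℂ) + 1) ≠ 0 := by
    apply Complex.Gamma_ne_zero_of_re_pos
    simp [hα]; positivity
  have h2 : Complex.Gamma (α + ((n + 1 : ℕ) : ℂ) + 1) =
      (α + (n : ℂ) + 1) * Complex.Gamma (α + (n : ℂ) + 1) := by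
    rw [← Complex.Gamma_add_one _ h1]; congr 1; push_cast; ring
  have h3 : (n.factorial : ℂ) ≠ 0 := by exact_mod_cast n.factorial_ne_zero
  have h4 : (n : ℂ) + 1 ≠ 0 := by exact_mod_cast n.succ_ne_zero
  unfold besC
  rw [h2, Nat.factorial_succ]
  push_cast
  field_simp
  ring

theorem besC_rapid {α : ℂ} (hα : α.re = 0) : RapidSeq (besC α) := by
  have hb : ∀ n, ‖besC α n‖ ≤ ‖besC α 0‖ * ((n.factorial : ℝ))⁻¹ := by
    intro n
    induction n with
    | zero => simp
    | succ n ih =>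
      have h1 := congrArg norm (besC_rec hα n)
      rw [norm_mul, norm_mul, norm_neg] at h1
      have h2 : ‖(n : ℂ) + 1‖ = n + 1 := by
        have : ((n : ℂ) + 1) = ((n + 1 : ℕ) : ℂ) := by push_cast; ring
        rw [this, Complex.norm_natCast]; push_cast; ring
      have h3 : 1 ≤ ‖α + (n : ℂ) + 1‖ := by
        refine le_trans ?_ (Complex.abs_re_le_norm _)
        simp [hα]
        exact le_trans (by linarith [(Nat.cast_nonneg n : (0:ℝ) ≤ n)]) (le_abs_self _)
      rw [h2] at h1
      have h4 : ‖besC α (n + 1)‖ * (n + 1) ≤ ‖besC α n‖ := by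
        rw [← h1]
        have : 0 ≤ ‖besC α (n + 1)‖ * ((n : ℝ) + 1) := by positivity
        nlinarith
      have h5 := h4.trans ih
      rw [Nat.factorial_succ]
      push_cast
      have h6 : (0 : ℝ) < n + 1 := by positivity
      rw [mul_inv, mul_comm ((n : ℝ) + 1)⁻¹, ← mul_assoc, ← div_eq_mul_inv _ ((n : ℝ) + 1),
        le_div_iff₀ h6]
      exact h5
  intro r hr
  refine Summable.of_nonneg_of_le (fun n => by positivity) (fun n => ?_)
    ((Real.summable_pow_div_factorial r).mul_left ‖besC α 0‖)
  have := mul_le_mul_of_nonneg_right (hb n) (pow_nonneg hr n)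
  refine this.trans (le_of_eq ?_)
  field_simp

/-- The function w solves the logarithmic Bessel equation, with derivative w1. -/
structure IsSol (μ : ℝ) (w w1 : ℝ → ℂ) : Prop where
  d0 : ∀ s, HasDerivAt w (w1 s) s
  d1 : ∀ s, HasDerivAt w1 (-(((Real.exp (2 * s) + μ ^ 2 : ℝ) : ℂ) * w s)) s

theorem bessel_isSol {α : ℂ} (hα : α.re = 0) {μ : ℝ} (hμ : α ^ 2 = -((μ ^ 2 : ℝ) : ℂ)) :
    ∃ w1, IsSol μ (fun s => besselJ α (Real.exp s)) w1 := by
  have hr := besC_rapid hα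
  have e0 : ∀ s : ℝ, besselJ α (Real.exp s) = expSer α (besC α) (s - Real.log 2) := by
    intro s
    rw [besselJ, Real.log_div (Real.exp_pos s).ne' (by norm_num), Real.log_exp]
    rfl
  have hs : ∀ s : ℝ, HasDerivAt (fun s : ℝ => s - Real.log 2) 1 s := fun s =>
    (hasDerivAt_id s).sub_const _
  refine ⟨fun s => expSer α (fun n => besC α n * (α + 2 * (n : ℂ))) (s - Real.log 2), ?_, ?_⟩
  · intro s
    have h1 := (expSer_hasDerivAt hr α (s - Real.log 2)).scomp s (hs s)
    rw [funext e0]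
    simpa [Function.comp_def] using h1
  · intro s
    have h1 := (expSer_hasDerivAt (hr.mulLin α) α (s - Real.log 2)).scomp s (hs s)
    have h2 : -(((Real.exp (2 * s) + μ ^ 2 : ℝ) : ℂ) * besselJ α (Real.exp s)) =
        expSer α (fun n => besC α n * (α + 2 * (n : ℂ)) * (α + 2 * (n : ℂ))) (s - Real.log 2) := by
      rw [e0]
      set y := s - Real.log 2 with hy
      have hexp : ((Real.exp (2 * s) : ℝ) : ℂ) = 4 * Complex.exp (2 * (y : ℂ)) := by
        have : Real.exp (2 * s) = 4 * Real.exp (2 * y) := by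
          have h3 : 2 * s = Real.log 4 + 2 * y := by
            have : Real.log 4 = 2 * Real.log 2 := by
              rw [show (4 : ℝ) = 2 ^ 2 by norm_num, Real.log_pow]; norm_num
            rw [this, hy]; ring
          rw [h3, Real.exp_add, Real.exp_log (by norm_num)]
        rw [this]; push_cast; ring_nf
      have hS := expSer_summable hr α y
      have hS2 := expSer_summable ((hr.mulLin α).mulLin α) α y
      unfold expSer
      have h5 : (∑' n : ℕ, (besC α n * (α + 2 * (n : ℂ)) * (α + 2 * (n : ℂ))) *
            Complex.exp ((α + 2 * (n : ℂ)) * (y : ℂ))) -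
          α ^ 2 * ∑' n : ℕ, besC α n * Complex.exp ((α + 2 * (n : ℂ)) * (y : ℂ)) =
          ∑' n : ℕ, (4 * (n : ℂ) * (α + n) * besC α n) *
            Complex.exp ((α + 2 * (n : ℂ)) * (y : ℂ)) := by
        rw [← tsum_mul_left, ← hS2.tsum_sub (hS.mul_left _)]
        congr 1; ext n; ring
      have hS3 : Summable fun n : ℕ => (4 * (n : ℂ) * (α + n) * besC α n) *
            Complex.exp ((α + 2 * (n : ℂ)) * (y : ℂ)) := by
        refine (hS2.sub (hS.mul_left (α ^ 2))).congr fun n => ?_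
        ring
      rw [hS3.tsum_eq_zero_add] at h5
      have h6 : ∀ n : ℕ, (4 * ((n + 1 : ℕ) : ℂ) * (α + ((n + 1 : ℕ) : ℂ)) * besC α (n + 1)) *
            Complex.exp ((α + 2 * ((n + 1 : ℕ) : ℂ)) * (y : ℂ)) =
          (-(4 * Complex.exp (2 * (y : ℂ)))) *
            (besC α n * Complex.exp ((α + 2 * (n : ℂ)) * (y : ℂ))) := by
        intro n
        have h7 : Complex.exp ((α + 2 * ((n + 1 : ℕ) : ℂ)) * (y : ℂ)) =
            Complex.exp (2 * (y : ℂ)) * Complex.exp ((α + 2 * (n : ℂ)) * (y : ℂ)) := by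
          rw [← Complex.exp_add]; congr 1; push_cast; ring
        have h8 := besC_rec hα n
        rw [h7]
        push_cast
        linear_combination (4 * Complex.exp (2 * (y : ℂ)) *
          Complex.exp ((α + 2 * (n : ℂ)) * (y : ℂ))) * h8
      simp_rw [h6] at h5
      rw [tsum_mul_left] at h5
      push_cast at hexp ⊢
      rw [hexp]
      push_cast at hμ
      rw [hμ] at h5
      simp only [Nat.cast_zero, mul_zero, zero_mul, zero_add] at h5
      linear_combination -h5
    rw [h2]
    simpa [Function.comp_def] using h1

theorem IsSol.conj {μ : ℝ} {w w1 : ℝ → ℂ} (h : IsSol μ w w1) :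
    IsSol μ (fun s => (starRingEnd ℂ) (w s)) (fun s => (starRingEnd ℂ) (w1 s)) := by
  refine ⟨fun s => ?_, fun s => ?_⟩
  · exact (Complex.conjCLE.toContinuousLinearMap.hasFDerivAt (x := w s)).comp_hasDerivAt s (h.d0 s)
  · have := (Complex.conjCLE.toContinuousLinearMap.hasFDerivAt (x := w1 s)).comp_hasDerivAt s
      (h.d1 s)
    refine this.congr_deriv ?_
    change (starRingEnd ℂ) _ = _
    simp only [map_neg, map_mul, Complex.conj_ofReal]

theorem IsSol.lin {μ : ℝ} {w w1 z z1 : ℝ → ℂ} (h : IsSol μ w w1) (h' : IsSol μ z z1) (a b : ℂ) :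
    IsSol μ (fun s => a * w s + b * z s) (fun s => a * w1 s + b * z1 s) := by
  refine ⟨fun s => ((h.d0 s).const_mul a).add ((h'.d0 s).const_mul b), fun s => ?_⟩
  refine (((h.d1 s).const_mul a).add ((h'.d1 s).const_mul b)).congr_deriv ?_
  ring

theorem IsSol.bound {μ : ℝ} (hμ : 0 < μ) {w w1 : ℝ → ℂ} (h : IsSol μ w w1) :
    ∃ C, 0 ≤ C ∧ ∀ s, ‖w s‖ ≤ C ∧ ‖w1 s‖ ≤ C * (1 + Real.exp s) := by
  set E : ℝ → ℝ := fun s => ‖w1 s‖ ^ 2 + (Real.exp (2 * s) + μ ^ 2) * ‖w s‖ ^ 2 with hE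
  have hexp : ∀ s : ℝ, HasDerivAt (fun s : ℝ => Real.exp (2 * s)) (2 * Real.exp (2 * s)) s := by
    intro s
    have h1 : HasDerivAt (fun s : ℝ => 2 * s) 2 s := by
      simpa using (hasDerivAt_id s).const_mul (2 : ℝ)
    exact h1.exp.congr_deriv (by ring)
  have hexpn : ∀ s : ℝ, HasDerivAt (fun s : ℝ => Real.exp (-(2 * s)))
      (-2 * Real.exp (-(2 * s))) s := by
    intro s
    have h1 : HasDerivAt (fun s : ℝ => -(2 * s)) (-2) s := by
      have h0 : HasDerivAt (fun s : ℝ => (-2) * s) (-2) s := by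
        simpa using (hasDerivAt_id s).const_mul (-2 : ℝ)
      simpa using h0
    exact h1.exp.congr_deriv (by ring)
  have hd : ∀ s, HasDerivAt E (2 * Real.exp (2 * s) * ‖w s‖ ^ 2) s := by
    intro s
    have h1 := (h.d1 s).norm_sq
    have h2 := (h.d0 s).norm_sq
    have h3 := h1.add (((hexp s).add_const (μ ^ 2)).mul h2)
    refine h3.congr_deriv ?_
    simp only [Complex.inner, Complex.mul_re, Complex.neg_re, Complex.neg_im, Complex.mul_im,
      Complex.ofReal_re, Complex.ofReal_im, Complex.conj_re, Complex.conj_im]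
    ring
  have hmono : Monotone E := monotone_of_hasDerivAt_nonneg hd fun s => by positivity
  have hanti : Antitone fun s => Real.exp (-(2 * s)) * E s := by
    refine antitone_of_hasDerivAt_nonpos (fun s => (hexpn s).mul (hd s)) fun s => ?_
    have : -2 * Real.exp (-(2 * s)) * E s + Real.exp (-(2 * s)) * (2 * Real.exp (2 * s) * ‖w s‖ ^ 2)
        = -2 * Real.exp (-(2 * s)) * (‖w1 s‖ ^ 2 + μ ^ 2 * ‖w s‖ ^ 2) := by
      simp only [hE]; ring
    simp only [Pi.zero_apply]
    rw [this]
    have h2 : 0 ≤ Real.exp (-(2 * s)) * (‖w1 s‖ ^ 2 + μ ^ 2 * ‖w s‖ ^ 2) := by positivity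
    linarith
  have hE0 : 0 ≤ E 0 := by simp only [hE]; positivity
  have hEb : ∀ s, 0 ≤ s → E s ≤ Real.exp (2 * s) * E 0 := by
    intro s hs
    have h1 := hanti hs
    simp only [mul_zero, neg_zero, Real.exp_zero, one_mul, Real.exp_neg] at h1
    rw [inv_mul_le_iff₀ (Real.exp_pos _)] at h1
    exact h1
  set C := Real.sqrt (E 0) * (1 + μ⁻¹) with hC
  have hs0 := Real.sqrt_nonneg (E 0)
  have hsq := Real.sq_sqrt hE0
  refine ⟨C, by positivity, fun s => ⟨?_, ?_⟩⟩
  · have hw := norm_nonneg (w s)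
    rcases le_total 0 s with hs | hs
    · have h1 := hEb s hs
      have h2 : ‖w s‖ ^ 2 ≤ Real.sqrt (E 0) ^ 2 := by
        rw [hsq]
        have h3 : Real.exp (2 * s) * ‖w s‖ ^ 2 ≤ E s := by
          simp only [hE]; nlinarith [sq_nonneg ‖w1 s‖, mul_nonneg (sq_nonneg μ) (sq_nonneg ‖w s‖)]
        exact le_of_mul_le_mul_left (h3.trans h1) (Real.exp_pos _)
      have h4 := le_of_abs_le (abs_le_of_sq_le_sq h2 hs0)
      have h5 : 0 ≤ Real.sqrt (E 0) * μ⁻¹ := by positivity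
      rw [hC]; linarith [h4]
    · have h1 := hmono hs
      have h2 : (μ * ‖w s‖) ^ 2 ≤ Real.sqrt (E 0) ^ 2 := by
        rw [hsq]
        refine le_trans ?_ h1
        simp only [hE]
        nlinarith [sq_nonneg ‖w1 s‖, mul_nonneg (Real.exp_pos (2 * s)).le (sq_nonneg ‖w s‖)]
      have h4 := le_of_abs_le (abs_le_of_sq_le_sq h2 hs0)
      rw [hC]
      have h5 : ‖w s‖ ≤ Real.sqrt (E 0) * μ⁻¹ := by
        rw [← div_eq_mul_inv, le_div_iff₀ hμ]; linarith
      linarith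
  · have h1 : E s ≤ E 0 * (1 + Real.exp (2 * s)) := by
      have := mul_nonneg hE0 (Real.exp_pos (2 * s)).le
      rcases le_total 0 s with hs | hs
      · linarith [hEb s hs]
      · linarith [hmono hs]
    have h2 : ‖w1 s‖ ^ 2 ≤ (Real.sqrt (E 0) * (1 + Real.exp s)) ^ 2 := by
      rw [mul_pow, hsq]
      have h3 : ‖w1 s‖ ^ 2 ≤ E s := by
        simp only [hE]
        have : 0 ≤ (Real.exp (2 * s) + μ ^ 2) * ‖w s‖ ^ 2 := by positivity
        linarith
      refine (h3.trans h1).trans (mul_le_mul_of_nonneg_left ?_ hE0)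
      have : Real.exp (2 * s) = Real.exp s ^ 2 := by
        rw [sq, ← Real.exp_add]; congr 1; ring
      rw [this]; nlinarith [Real.exp_pos s]
    have h4 := le_of_abs_le (abs_le_of_sq_le_sq h2 (by positivity))
    refine h4.trans (mul_le_mul_of_nonneg_right ?_ (by positivity))
    rw [hC]
    have : 0 ≤ Real.sqrt (E 0) * μ⁻¹ := by positivity
    linarith

/-- Measurable functions on `ℝ³` all of whose polynomial moments are integrable. -/
def Rap (a : V3 → ℂ) : Prop :=
  AEStronglyMeasurable a volume ∧ ∀ N : ℕ, Integrable (fun k => (1 + ‖k‖) ^ N * ‖a k‖) volume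

theorem Rap.integrable {a : V3 → ℂ} (ha : Rap a) : Integrable a volume := by
  have := ha.2 0
  simp only [pow_zero, one_mul] at this
  exact (integrable_norm_iff ha.1).1 this

theorem Rap.mul {a g : V3 → ℂ} (ha : Rap a) (hg : AEStronglyMeasurable g volume) (C : ℝ) (M : ℕ)
    (hb : ∀ᵐ k : V3, ‖g k‖ ≤ C * (1 + ‖k‖) ^ M) : Rap fun k => g k * a k := by
  refine ⟨hg.mul ha.1, fun N => ?_⟩
  refine ((ha.2 (N + M)).const_mul C).mono' ?_ ?_
  · exact (by fun_prop : AEStronglyMeasurable (fun k : V3 => (1 + ‖k‖) ^ N) volume).mul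
      (hg.mul ha.1).norm
  · filter_upwards [hb] with k hk
    have h0 : 0 ≤ (1 + ‖k‖) ^ N * ‖a k‖ := by positivity
    rw [Real.norm_of_nonneg (by positivity), norm_mul, pow_add]
    nlinarith [mul_le_mul_of_nonneg_left hk h0]

theorem Rap.add {a b : V3 → ℂ} (ha : Rap a) (hb : Rap b) : Rap fun k => a k + b k := by
  refine ⟨ha.1.add hb.1, fun N => ?_⟩
  refine ((ha.2 N).add (hb.2 N)).mono' ?_ ?_
  · exact (by fun_prop : AEStronglyMeasurable (fun k : V3 => (1 + ‖k‖) ^ N) volume).mul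
      (ha.1.add hb.1).norm
  · refine Eventually.of_forall fun k => ?_
    rw [Real.norm_of_nonneg (by positivity)]
    have h0 : 0 ≤ (1 + ‖k‖) ^ N := by positivity
    simp only [Pi.add_apply]
    nlinarith [mul_le_mul_of_nonneg_left (norm_add_le (a k) (b k)) h0]

theorem Rap.const_mul {a : V3 → ℂ} (ha : Rap a) (c : ℂ) : Rap fun k => c * a k :=
  ha.mul aestronglyMeasurable_const ‖c‖ 0 (by simp)

theorem Rap.congr {a b : V3 → ℂ} (ha : Rap a) (h : a =ᵐ[volume] b) : Rap b := by
  refine ⟨ha.1.congr h, fun N => (ha.2 N).congr ?_⟩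
  filter_upwards [h] with k hk
  rw [hk]

theorem Rap.conj_neg {a : V3 → ℂ} (ha : Rap a) : Rap fun k => (starRingEnd ℂ) (a (-k)) := by
  refine ⟨?_, fun N => ?_⟩
  · exact Complex.continuous_conj.comp_aestronglyMeasurable
      (ha.1.comp_measurePreserving (Measure.measurePreserving_neg (volume : Measure V3)))
  · have := (ha.2 N).comp_neg
    simpa using this

theorem Rap.coord {a : V3 → ℂ} (ha : Rap a) (j : Fin 3) :
    Rap fun k => (Complex.I * (k j : ℂ)) * a k := by
  refine ha.mul ?_ 1 1 (Eventually.of_forall fun k => ?_)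
  · exact Continuous.aestronglyMeasurable (by fun_prop)
  · rw [norm_mul, Complex.norm_I, one_mul, Complex.norm_real, one_mul, pow_one]
    have := PiLp.norm_apply_le k j
    linarith [norm_nonneg k]

theorem Rap.normSq {a : V3 → ℂ} (ha : Rap a) :
    Rap fun k => ((‖k‖ ^ 2 : ℝ) : ℂ) * a k := by
  refine ha.mul ?_ 1 2 (Eventually.of_forall fun k => ?_)
  · exact Continuous.aestronglyMeasurable (by fun_prop)
  · rw [Complex.norm_real, Real.norm_of_nonneg (by positivity), one_mul]
    nlinarith [norm_nonneg k]

/-- Growth bound for functions of the logarithmic variable. -/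
def Gr (w : ℝ → ℂ) (C : ℝ) (N : ℕ) : Prop := ∀ s, ‖w s‖ ≤ C * (1 + Real.exp s) ^ N

theorem Gr.apply {w : ℝ → ℂ} {C : ℝ} {N : ℕ} (h : Gr w C N) (hC : 0 ≤ C) {s S : ℝ} (hs : s ≤ S)
    {k : V3} (hk : k ≠ 0) :
    ‖w (s + Real.log ‖k‖)‖ ≤ C * (1 + Real.exp S) ^ N * (1 + ‖k‖) ^ N := by
  refine (h _).trans ?_
  rw [Real.exp_add, Real.exp_log (norm_pos_iff.2 hk), mul_assoc, ← mul_pow]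
  have h1 := Real.exp_le_exp.2 hs
  have h2 := norm_nonneg k
  have h3 := Real.exp_pos s
  gcongr
  nlinarith

theorem meas_w {w : ℝ → ℂ} (hw : Continuous w) (s : ℝ) :
    AEStronglyMeasurable (fun k : V3 => w (s + Real.log ‖k‖)) volume := by
  have : Measurable fun k : V3 => w (s + Real.log ‖k‖) :=
    hw.measurable.comp (by fun_prop)
  exact this.aestronglyMeasurable

theorem ae_ne_zero : ∀ᵐ k : V3, k ≠ 0 := by
  have := (measure_singleton (0 : V3) : (volume : Measure V3) {0} = 0)
  exact measure_eq_zero_iff_ae_notMem.1 this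

theorem Rap.mulw {a : V3 → ℂ} (ha : Rap a) {w : ℝ → ℂ} (hw : Continuous w) {C : ℝ} {N : ℕ}
    (hC : 0 ≤ C) (hb : Gr w C N) (s : ℝ) : Rap fun k => w (s + Real.log ‖k‖) * a k :=
  ha.mul (meas_w hw s) _ N (ae_ne_zero.mono fun _ hk => hb.apply hC le_rfl hk)

theorem Rap.mule {a : V3 → ℂ} (ha : Rap a) (x : V3) :
    Rap fun k => Complex.exp (Complex.I * (⟪k, x⟫ : ℂ)) * a k := by
  refine ha.mul ?_ 1 0 (Eventually.of_forall fun k => ?_)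
  · exact Continuous.aestronglyMeasurable (by fun_prop)
  · rw [mul_comm Complex.I, Complex.norm_exp_ofReal_mul_I]; simp

/-- The parametric integral. -/
def UU (w : ℝ → ℂ) (a : V3 → ℂ) (p : ℝ × V3) : ℂ :=
  ∫ k : V3, Complex.exp (Complex.I * (⟪k, p.2⟫ : ℂ)) * (w (p.1 + Real.log ‖k‖) * a k)

/-- First coordinate as a continuous linear map into `ℂ`. -/
def CoT : ℝ × V3 →L[ℝ] ℂ := Complex.ofRealCLM.comp (ContinuousLinearMap.fst ℝ ℝ V3)

/-- Spatial coordinate as a continuous linear map into `ℂ`. -/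
def CoX (j : Fin 3) : ℝ × V3 →L[ℝ] ℂ :=
  Complex.ofRealCLM.comp ((EuclideanSpace.proj j).comp (ContinuousLinearMap.snd ℝ ℝ V3))

theorem UU_hasFDerivAt {w w1 : ℝ → ℂ} (hd : ∀ s, HasDerivAt w (w1 s) s) (hw1 : Continuous w1)
    {C : ℝ} {N : ℕ} (hC : 0 ≤ C) (hb : Gr w C N) (hb1 : Gr w1 C N) {a : V3 → ℂ} (ha : Rap a)
    (p : ℝ × V3) :
    HasFDerivAt (UU w a)
      (UU w1 a p • CoT + ∑ j, UU w (fun k => (Complex.I * (k j : ℂ)) * a k) p • CoX j) p := by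
  have hw : Continuous w := continuous_iff_continuousAt.2 fun s => (hd s).continuousAt
  set F : ℝ × V3 → V3 → ℂ := fun p k =>
    Complex.exp (Complex.I * (⟪k, p.2⟫ : ℂ)) * (w (p.1 + Real.log ‖k‖) * a k) with hF
  set F' : ℝ × V3 → V3 → (ℝ × V3 →L[ℝ] ℂ) := fun p k =>
    (Complex.exp (Complex.I * (⟪k, p.2⟫ : ℂ)) * (w1 (p.1 + Real.log ‖k‖) * a k)) • CoT +
    ∑ j, (Complex.exp (Complex.I * (⟪k, p.2⟫ : ℂ)) *
      (w (p.1 + Real.log ‖k‖) * ((Complex.I * (k j : ℂ)) * a k))) • CoX j with hF'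
  have hrF : ∀ p, Rap (F p) := fun p => (ha.mulw hw hC hb p.1).mule p.2
  have hr1 : Rap fun k => Complex.exp (Complex.I * (⟪k, p.2⟫ : ℂ)) *
    (w1 (p.1 + Real.log ‖k‖) * a k) := (ha.mulw hw1 hC hb1 p.1).mule p.2
  have hr2 : ∀ j, Rap fun k => Complex.exp (Complex.I * (⟪k, p.2⟫ : ℂ)) *
      (w (p.1 + Real.log ‖k‖) * ((Complex.I * (k j : ℂ)) * a k)) := fun j =>
    ((ha.coord j).mulw hw hC hb p.1).mule p.2
  have hi1 := hr1.integrable.smul_const CoT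
  have hi2 := fun j => (hr2 j).integrable.smul_const (CoX j)
  have hint : (UU w1 a p • CoT + ∑ j, UU w (fun k => (Complex.I * (k j : ℂ)) * a k) p • CoX j) =
      ∫ k, F' p k := by
    simp only [hF']
    rw [integral_add hi1 (integrable_finsetSum _ fun j _ => hi2 j),
      integral_finsetSum _ fun j _ => hi2 j, integral_smul_const]
    simp_rw [integral_smul_const]
    rfl
  rw [hint]
  set D := C * (1 + Real.exp (p.1 + 1)) ^ N with hD
  have hD0 : 0 ≤ D := by positivity
  refine hasFDerivAt_integral_of_dominated_of_fderiv_le (F := F) (F' := F')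
    (s := Metric.ball p 1)
    (bound := fun k => (D * (‖CoT‖ + ∑ j, ‖CoX j‖)) * ((1 + ‖k‖) ^ (N + 1) * ‖a k‖))
    (Metric.ball_mem_nhds p one_pos) (Eventually.of_forall fun q => (hrF q).1)
    (hrF p).integrable (hi1.add (integrable_finsetSum _ fun j _ => hi2 j)).1 ?_
    ((ha.2 (N + 1)).const_mul _) ?_
  · filter_upwards [ae_ne_zero] with k hk q hq
    have hq1 : q.1 ≤ p.1 + 1 := by
      have h1 : dist q p < 1 := hq
      have h2 : dist q.1 p.1 ≤ dist q p := by rw [Prod.dist_eq]; exact le_max_left _ _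
      have h3 := le_abs_self (q.1 - p.1)
      rw [Real.dist_eq] at h2
      linarith
    have e1 := hb.apply hC hq1 hk
    have e2 := hb1.apply hC hq1 hk
    rw [← hD] at e1 e2
    have hk1 : 1 ≤ 1 + ‖k‖ := by linarith [norm_nonneg k]
    have hP : D * (1 + ‖k‖) ^ N ≤ D * (1 + ‖k‖) ^ (N + 1) :=
      mul_le_mul_of_nonneg_left (pow_le_pow_right₀ hk1 (Nat.le_succ N)) hD0
    have hexp : ‖Complex.exp (Complex.I * (⟪k, q.2⟫ : ℂ))‖ = 1 := by
      rw [mul_comm Complex.I, Complex.norm_exp_ofReal_mul_I]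
    have t1 : ‖(Complex.exp (Complex.I * (⟪k, q.2⟫ : ℂ)) * (w1 (q.1 + Real.log ‖k‖) * a k))‖ ≤
        D * ((1 + ‖k‖) ^ (N + 1) * ‖a k‖) := by
      rw [norm_mul, hexp, one_mul, norm_mul, ← mul_assoc]
      exact mul_le_mul_of_nonneg_right (e2.trans hP) (norm_nonneg _)
    have t2 : ∀ j, ‖(Complex.exp (Complex.I * (⟪k, q.2⟫ : ℂ)) *
        (w (q.1 + Real.log ‖k‖) * ((Complex.I * (k j : ℂ)) * a k)))‖ ≤
        D * ((1 + ‖k‖) ^ (N + 1) * ‖a k‖) := by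
      intro j
      rw [norm_mul, hexp, one_mul, norm_mul, norm_mul, norm_mul, Complex.norm_I, one_mul,
        Complex.norm_real, pow_succ]
      have h1 : ‖k j‖ ≤ 1 + ‖k‖ := (PiLp.norm_apply_le k j).trans (by linarith)
      calc _ ≤ (D * (1 + ‖k‖) ^ N) * ((1 + ‖k‖) * ‖a k‖) := by gcongr
        _ = _ := by ring
    simp only [hF']
    refine (norm_add_le _ _).trans ?_
    rw [norm_smul]
    have h5 : ‖∑ j, (Complex.exp (Complex.I * (⟪k, q.2⟫ : ℂ)) *
        (w (q.1 + Real.log ‖k‖) * ((Complex.I * (k j : ℂ)) * a k))) • CoX j‖ ≤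
        ∑ j, D * ((1 + ‖k‖) ^ (N + 1) * ‖a k‖) * ‖CoX j‖ := by
      refine norm_sum_le_of_le _ fun j _ => ?_
      rw [norm_smul]
      exact mul_le_mul_of_nonneg_right (t2 j) (norm_nonneg _)
    have h6 := mul_le_mul_of_nonneg_right t1 (norm_nonneg CoT)
    rw [← Finset.mul_sum] at h5
    calc _ ≤ _ := add_le_add h6 h5
      _ = _ := by ring
  · refine Eventually.of_forall fun k q _ => ?_
    have g1 : HasFDerivAt (fun q : ℝ × V3 => w (q.1 + Real.log ‖k‖))
        ((ContinuousLinearMap.fst ℝ ℝ V3).smulRight (w1 (q.1 + Real.log ‖k‖))) q := by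
      have := (hd (q.1 + Real.log ‖k‖)).hasFDerivAt.comp q
        ((hasFDerivAt_fst (𝕜 := ℝ) (p := q)).add_const (Real.log ‖k‖))
      refine this.congr_fderiv ?_
      ext <;> simp
    have g2 : HasFDerivAt (fun q : ℝ × V3 => Complex.I * (⟪k, q.2⟫ : ℂ))
        (Complex.I • (Complex.ofRealCLM.comp
          ((innerSL ℝ k).comp (ContinuousLinearMap.snd ℝ ℝ V3)))) q := by
      exact ((Complex.ofRealCLM.comp
          ((innerSL ℝ k).comp (ContinuousLinearMap.snd ℝ ℝ V3))).hasFDerivAt (x := q)).const_mul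
            Complex.I
    have g3 := g2.cexp.mul (g1.mul_const (a k))
    refine g3.congr_fderiv ?_
    refine ContinuousLinearMap.ext fun v => ?_
    have hin : (⟪k, v.2⟫ : ℝ) = ∑ j, k j * v.2 j := by
      rw [PiLp.inner_apply]
      refine Finset.sum_congr rfl fun j _ => ?_
      simp [mul_comm]
    simp [hF', CoT, CoX, hin, Fin.sum_univ_three]
    ring

theorem UU_contDiff {μ : ℝ} (hμ : 0 < μ) {w w1 : ℝ → ℂ} (h : IsSol μ w w1) (n : ℕ) :
    ∀ a, Rap a → ContDiff ℝ n (UU w a) ∧ ContDiff ℝ n (UU w1 a) := by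
  obtain ⟨C, hC, hbd⟩ := h.bound hμ
  set w2 : ℝ → ℂ := fun s => -(((Real.exp (2 * s) + μ ^ 2 : ℝ) : ℂ) * w s) with hw2
  have hw : Continuous w := continuous_iff_continuousAt.2 fun s => (h.d0 s).continuousAt
  have hw1 : Continuous w1 := continuous_iff_continuousAt.2 fun s => (h.d1 s).continuousAt
  have hw2c : Continuous w2 := by simp only [hw2]; fun_prop
  set B := C * (1 + μ ^ 2) with hB
  have hB0 : 0 ≤ B := by positivity
  have hCB : C ≤ B := by rw [hB]; nlinarith [sq_nonneg μ]
  have b0 : Gr w B 2 := fun s => by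
    have h1 : 1 ≤ (1 + Real.exp s) ^ 2 := one_le_pow₀ (by linarith [Real.exp_pos s])
    have := (hbd s).1
    nlinarith
  have b1 : Gr w1 B 2 := fun s => by
    have h1 : 1 ≤ 1 + Real.exp s := by linarith [Real.exp_pos s]
    refine (hbd s).2.trans ?_
    have h2 : (1 + Real.exp s) ≤ (1 + Real.exp s) ^ 2 := by nlinarith
    gcongr
  have b2 : Gr w2 B 2 := fun s => by
    simp only [hw2]
    rw [norm_neg, norm_mul, Complex.norm_real, Real.norm_of_nonneg (by positivity)]
    have h1 : Real.exp (2 * s) = Real.exp s ^ 2 := by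
      rw [sq, ← Real.exp_add]; congr 1; ring
    have h2 := Real.exp_pos s
    rw [h1]
    have h3 : Real.exp s ^ 2 + μ ^ 2 ≤ (1 + μ ^ 2) * (1 + Real.exp s) ^ 2 := by
      have : 0 ≤ μ ^ 2 * (2 * Real.exp s + Real.exp s ^ 2) := by positivity
      nlinarith
    calc _ ≤ ((1 + μ ^ 2) * (1 + Real.exp s) ^ 2) * C :=
          mul_le_mul h3 (hbd s).1 (norm_nonneg _) (by positivity)
      _ = _ := by rw [hB]; ring
  have hU2 : ∀ a, Rap a → UU w2 a = fun p : ℝ × V3 =>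
      -(((Real.exp (2 * p.1) : ℝ) : ℂ) * UU w (fun k => ((‖k‖ ^ 2 : ℝ) : ℂ) * a k) p +
        ((μ ^ 2 : ℝ) : ℂ) * UU w a p) := by
    intro a ha
    funext p
    have i1 := (((ha.normSq).mulw hw hB0 b0 p.1).mule p.2).integrable
    have i2 := ((ha.mulw hw hB0 b0 p.1).mule p.2).integrable
    unfold UU
    rw [← integral_const_mul, ← integral_const_mul, ← integral_add (i1.const_mul _)
      (i2.const_mul _), ← integral_neg]
    refine integral_congr_ae (ae_ne_zero.mono fun k hk => ?_)
    have h1 : Real.exp (2 * (p.1 + Real.log ‖k‖)) = Real.exp (2 * p.1) * ‖k‖ ^ 2 := by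
      have h2 : 2 * (p.1 + Real.log ‖k‖) = 2 * p.1 + (Real.log ‖k‖ + Real.log ‖k‖) := by ring
      rw [h2, Real.exp_add, Real.exp_add, Real.exp_log (norm_pos_iff.2 hk), sq]
    simp only [hw2]
    rw [h1]
    push_cast
    ring
  have hf := fun a (ha : Rap a) => UU_hasFDerivAt h.d0 hw1 hB0 b0 b1 ha
  have hf1 := fun a (ha : Rap a) => UU_hasFDerivAt h.d1 hw2c hB0 b1 b2 ha
  induction n with
  | zero =>
    intro a ha
    exact ⟨contDiff_zero.2 (continuous_iff_continuousAt.2 fun p => (hf a ha p).continuousAt),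
      contDiff_zero.2 (continuous_iff_continuousAt.2 fun p => (hf1 a ha p).continuousAt)⟩
  | succ n ih =>
    intro a ha
    have hU2c : ContDiff ℝ n (UU w2 a) := by
      rw [hU2 a ha]
      have h1 := (ih a ha).1
      have h2 := (ih _ ha.normSq).1
      have h3 : ContDiff ℝ n fun p : ℝ × V3 => ((Real.exp (2 * p.1) : ℝ) : ℂ) :=
        Complex.ofRealCLM.contDiff.comp
          (Real.contDiff_exp.comp (contDiff_const.mul contDiff_fst))
      exact ((h3.mul h2).add (contDiff_const.mul h1)).neg
    constructor
    · refine contDiff_succ_iff_hasFDerivAt.2 ⟨_, ?_, hf a ha⟩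
      exact ((ih a ha).2.smul contDiff_const).add
        (ContDiff.sum fun j _ => ((ih _ (ha.coord j)).1.smul contDiff_const))
    · refine contDiff_succ_iff_hasFDerivAt.2 ⟨_, ?_, hf1 a ha⟩
      exact (hU2c.smul contDiff_const).add
        (ContDiff.sum fun j _ => ((ih _ (ha.coord j)).2.smul contDiff_const))

theorem schwartz_rap (S : SchwartzMap V3 ℂ) : Rap S := by
  refine ⟨S.continuous.aestronglyMeasurable, fun N => ?_⟩
  have h1 := ((S.integrable_pow_mul volume 0).add (S.integrable_pow_mul volume N)).const_mul
    ((2 : ℝ) ^ (N - 1))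
  refine h1.mono' ?_ (Eventually.of_forall fun k => ?_)
  · exact Continuous.aestronglyMeasurable (by have := S.continuous; fun_prop)
  · rw [Real.norm_of_nonneg (by positivity)]
    have h2 := add_pow_le (zero_le_one (α := ℝ)) (norm_nonneg k) N
    have h3 := mul_le_mul_of_nonneg_right h2 (norm_nonneg (S k))
    simp only [Pi.add_apply, pow_zero, one_mul, one_pow] at h3 ⊢
    linarith

theorem ft_rap (f : SchwartzMap V3 ℝ) : Rap (ft fun x => (f x : ℂ)) := by
  have h2 : ((2 * Real.pi)⁻¹ : ℝ) ≠ 0 := by positivity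
  set g : SchwartzMap V3 ℂ := f.postcompCLM Complex.ofRealCLM with hg
  set S : SchwartzMap V3 ℂ := SchwartzMap.compCLMOfContinuousLinearEquiv ℂ
    (ContinuousLinearEquiv.smulLeft (Units.mk0 _ h2) : V3 ≃L[ℝ] V3)
    (FourierTransform.fourier g) with hS
  have h3 : (ft fun x => (f x : ℂ)) =
      fun k => (((2 * Real.pi) ^ (-(3 : ℝ) / 2) : ℝ) : ℂ) * S k := by
    funext k
    unfold ft
    congr 1
    have h4 : S k = (FourierTransform.fourier g) ((2 * Real.pi)⁻¹ • k) := rfl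
    rw [h4, SchwartzMap.fourier_coe, Real.fourier_eq']
    congr 1
    funext x
    have h5 : g x = (f x : ℂ) := rfl
    rw [h5, smul_eq_mul, real_inner_smul_right, real_inner_comm k x]
    congr 2
    have : -2 * Real.pi * ((2 * Real.pi)⁻¹ * ⟪k, x⟫) = - ⟪k, x⟫ := by
      have := Real.pi_pos.ne'
      field_simp
    rw [this]
    push_cast
    ring
  rw [h3]
  exact (schwartz_rap S).const_mul _

theorem hankel_isSol {m R : ℝ} (hmR : 3 / 2 < m * R) :
    0 < modeMu m R ∧ ∃ w1, IsSol (modeMu m R) (fun s => hankel1 (modeNu m R) (Real.exp s)) w1 := by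
  have hμ : 0 < modeMu m R := Real.sqrt_pos.2 (by nlinarith)
  refine ⟨hμ, ?_⟩
  have hre : (modeNu m R).re = 0 := by simp [modeNu]
  have hsq : (modeNu m R) ^ 2 = -((modeMu m R ^ 2 : ℝ) : ℂ) := by
    rw [modeNu, mul_pow, Complex.I_sq]; push_cast; ring
  obtain ⟨a1, ha⟩ := bessel_isSol hre hsq
  obtain ⟨b1, hb⟩ := bessel_isSol (α := -modeNu m R) (μ := modeMu m R) (by simp [hre])
    (by rw [neg_sq]; exact hsq)
  have h := hb.lin ha (Complex.I * Complex.sin (modeNu m R * (Real.pi : ℂ)))⁻¹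
    (-(Complex.exp (-(Complex.I * (Real.pi : ℂ) * modeNu m R)) *
      (Complex.I * Complex.sin (modeNu m R * (Real.pi : ℂ)))⁻¹))
  have e : (fun s => hankel1 (modeNu m R) (Real.exp s)) = fun s : ℝ =>
      (Complex.I * Complex.sin (modeNu m R * (Real.pi : ℂ)))⁻¹ *
        besselJ (-modeNu m R) (Real.exp s) +
      (-(Complex.exp (-(Complex.I * (Real.pi : ℂ) * modeNu m R)) *
      (Complex.I * Complex.sin (modeNu m R * (Real.pi : ℂ)))⁻¹)) *
        besselJ (modeNu m R) (Real.exp s) := by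
    funext s
    rw [hankel1, div_eq_mul_inv]
    ring
  rw [e]
  exact ⟨_, h⟩

theorem modeV_eq (m R : ℝ) {t k : ℝ} (ht : 0 < t) (hk : 0 < k) :
    modeV m R t k = (Real.exp (-(modeMu m R * Real.pi / 2)) : ℂ) *
      ((t ^ ((3 : ℝ) / 2) : ℝ) : ℂ) *
      hankel1 (modeNu m R) (Real.exp (Real.log t + Real.log k)) := by
  rw [modeV, Real.exp_add, Real.exp_log ht, Real.exp_log hk, mul_comm t k]

theorem modeV'_eq (m R : ℝ) {μ : ℝ} {w1 : ℝ → ℂ}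
    (h : IsSol μ (fun s => hankel1 (modeNu m R) (Real.exp s)) w1) {t : ℝ} (ht : 0 < t) :
    ∃ c1 c2 : ℂ, ∀ k : ℝ, 0 < k → modeV' m R t k =
      c1 * hankel1 (modeNu m R) (Real.exp (Real.log t + Real.log k)) +
      c2 * w1 (Real.log t + Real.log k) := by
  set A : ℂ := (Real.exp (-(modeMu m R * Real.pi / 2)) : ℂ)
  refine ⟨A * ((((3 : ℝ) / 2) * t ^ ((3 : ℝ) / 2 - 1) : ℝ) : ℂ),
    A * ((t ^ ((3 : ℝ) / 2) : ℝ) : ℂ) * ((t⁻¹ : ℝ) : ℂ), fun k hk => ?_⟩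
  have h1 : HasDerivAt (fun s : ℝ => ((s ^ ((3 : ℝ) / 2) : ℝ) : ℂ))
      ((((3 : ℝ) / 2) * t ^ ((3 : ℝ) / 2 - 1) : ℝ) : ℂ) t :=
    (Real.hasDerivAt_rpow_const (Or.inl ht.ne')).ofReal_comp
  have h2 := (h.d0 (Real.log t + Real.log k)).scomp t
    ((Real.hasDerivAt_log ht.ne').add_const (Real.log k))
  have h3 := (h1.const_mul A).mul h2
  have h4 := h3.congr_of_eventuallyEq (f₁ := fun s => modeV m R s k) (by
    filter_upwards [lt_mem_nhds ht] with s hs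
    exact modeV_eq m R hs hk)
  rw [modeV', h4.deriv]
  simp only [Function.comp_apply, Complex.real_smul]
  ring

theorem psi_rap {m R : ℝ} (hmR : 3 / 2 < m * R) (f h : SchwartzMap V3 ℝ) {t₀ : ℝ} (ht₀ : 0 < t₀) :
    Rap (ktFun m R t₀ ⇑f ⇑h) := by
  obtain ⟨hμ, w1, hs⟩ := hankel_isSol hmR
  obtain ⟨c1, c2, hc⟩ := modeV'_eq m R hs ht₀
  obtain ⟨C, hC, hbd⟩ := hs.conj.bound hμ
  have hcj := hs.conj
  have k0 : Continuous fun s => (starRingEnd ℂ) (hankel1 (modeNu m R) (Real.exp s)) :=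
    continuous_iff_continuousAt.2 fun s => (hcj.d0 s).continuousAt
  have k1 : Continuous fun s => (starRingEnd ℂ) (w1 s) :=
    continuous_iff_continuousAt.2 fun s => (hcj.d1 s).continuousAt
  have g0 : Gr (fun s => (starRingEnd ℂ) (hankel1 (modeNu m R) (Real.exp s))) C 0 := fun s => by
    simpa using (hbd s).1
  have g1 : Gr (fun s => (starRingEnd ℂ) (w1 s)) C 1 := fun s => by
    rw [pow_one]; exact (hbd s).2
  have r1 := (ft_rap f).mulw k0 hC g0 (Real.log t₀)
  have r2 := (ft_rap f).mulw k1 hC g1 (Real.log t₀)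
  have r3 := (ft_rap h).mulw k0 hC g0 (Real.log t₀)
  have r := (((r1.const_mul ((starRingEnd ℂ) c1)).add
    (r2.const_mul ((starRingEnd ℂ) c2))).const_mul (t₀ : ℂ)).add
    (r3.const_mul (-(R : ℂ) * ((Real.exp (-(modeMu m R * Real.pi / 2)) : ℂ) *
      ((t₀ ^ ((3 : ℝ) / 2) : ℝ) : ℂ))))
  refine (r.const_mul ((Real.pi : ℂ) * Complex.I / (4 * (t₀ : ℂ) ^ 3))).congr ?_
  filter_upwards [ae_ne_zero] with k hk
  have hk' := norm_pos_iff.2 hk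
  simp only [ktFun, ktAux]
  rw [hc _ hk', modeV_eq m R ht₀ hk']
  simp only [map_add, map_mul, Complex.conj_ofReal]
  ring

/-- the solution `u` with Schwartz Cauchy data at time `t₀ > 0`
is `C^∞` on `(0,∞) × ℝ³`. -/
theorem solution_smooth (m R : ℝ) (hm : 0 < m) (hR : 0 < R) (hmR : 3 / 2 < m * R)
    (f h : SchwartzMap V3 ℝ) (t₀ : ℝ) (ht₀ : 0 < t₀) :
    ContDiffOn ℝ (⊤ : ℕ∞) (fun p : ℝ × V3 => uSol m R (ktFun m R t₀ ⇑f ⇑h) p.1 p.2)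
      (Set.Ioi (0 : ℝ) ×ˢ (Set.univ : Set V3)) := by
  obtain ⟨hμ, w1, hs⟩ := hankel_isSol hmR
  have hψ := psi_rap hmR f h ht₀
  set ψ := ktFun m R t₀ ⇑f ⇑h with hψd
  set w : ℝ → ℂ := fun s => hankel1 (modeNu m R) (Real.exp s) with hw
  set wc : ℝ → ℂ := fun s => (starRingEnd ℂ) (w s) with hwc
  have hsc : IsSol (modeMu m R) wc (fun s => (starRingEnd ℂ) (w1 s)) := hs.conj
  have hψc := hψ.conj_neg
  set ψc : V3 → ℂ := fun k => (starRingEnd ℂ) (ψ (-k)) with hψcd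
  have s1 : ContDiff ℝ (⊤ : ℕ∞) (UU w ψ) :=
    contDiff_infty.2 fun n => (UU_contDiff hμ hs n ψ hψ).1
  have s2 : ContDiff ℝ (⊤ : ℕ∞) (UU wc ψc) :=
    contDiff_infty.2 fun n => (UU_contDiff hμ hsc n ψc hψc).1
  have hlog : ContDiffOn ℝ (⊤ : ℕ∞) (fun p : ℝ × V3 => (Real.log p.1, p.2))
      (Set.Ioi (0 : ℝ) ×ˢ (Set.univ : Set V3)) := by
    refine ContDiffOn.prodMk ?_ contDiff_snd.contDiffOn
    exact contDiff_fst.contDiffOn.log fun p hp => (ne_of_gt hp.1)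
  have hpow : ContDiffOn ℝ (⊤ : ℕ∞) (fun p : ℝ × V3 => ((p.1 ^ ((3 : ℝ) / 2) : ℝ) : ℂ))
      (Set.Ioi (0 : ℝ) ×ˢ (Set.univ : Set V3)) := by
    have h1 : ContDiffOn ℝ (⊤ : ℕ∞) (fun p : ℝ × V3 => p.1 ^ ((3 : ℝ) / 2))
        (Set.Ioi (0 : ℝ) ×ˢ (Set.univ : Set V3)) :=
      contDiff_fst.contDiffOn.rpow_const_of_ne fun p hp => (ne_of_gt hp.1)
    exact Complex.ofRealCLM.contDiff.comp_contDiffOn h1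
  have hmain : ContDiffOn ℝ (⊤ : ℕ∞) (fun p : ℝ × V3 =>
      ((((2 * Real.pi) ^ (-(3 : ℝ) / 2) : ℝ) : ℂ) *
        (Real.exp (-(modeMu m R * Real.pi / 2)) : ℂ)) * ((p.1 ^ ((3 : ℝ) / 2) : ℝ) : ℂ) *
        (UU w ψ (Real.log p.1, p.2) + UU wc ψc (Real.log p.1, p.2)))
      (Set.Ioi (0 : ℝ) ×ˢ (Set.univ : Set V3)) :=
    (contDiffOn_const.mul hpow).mul
      ((s1.comp_contDiffOn hlog).add (s2.comp_contDiffOn hlog))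
  refine hmain.congr fun p hp => ?_
  have ht : 0 < p.1 := hp.1
  have hint : ∀ {z z1 : ℝ → ℂ} {a : V3 → ℂ}, IsSol (modeMu m R) z z1 → Rap a →
      Integrable (fun k : V3 => Complex.exp (Complex.I * (⟪k, p.2⟫ : ℂ)) *
        (z (Real.log p.1 + Real.log ‖k‖) * a k)) volume := by
    intro z z1 a hz ha
    obtain ⟨C, hC, hbd⟩ := hz.bound hμ
    have k0 : Continuous z := continuous_iff_continuousAt.2 fun s => (hz.d0 s).continuousAt
    have g0 : Gr z C 0 := fun s => by simpa using (hbd s).1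
    exact ((ha.mulw k0 hC g0 _).mule _).integrable
  unfold uSol UU
  have hadd := integral_add (hint hs hψ) (hint hsc hψc)
  rw [← hadd, 
    show ∀ a b c X : ℂ, a * b * c * X = a * ((b * c) * X) from fun a b c X => by ring,
    ← integral_const_mul, ← integral_const_mul, ← integral_const_mul]
  refine integral_congr_ae (ae_ne_zero.mono fun k hk => ?_)
  simp only [modeV_eq m R ht (norm_pos_iff.2 hk), hwc, hw, hψcd, map_mul, Complex.conj_ofReal]
  ring
end
end

section
/- There is a constant C > 0 such that for every t ≥ 1 and all real Schwartz functions f, h on ℝ³, ‖K_t(f,h)‖_{L²(ℝ³)} ≤ C·t·‖(f,h)‖_{1/2}, where ‖(f,h)‖_{1/2}² = ∫_{ℝ³} ω(|k⃗|)·|f̃(k⃗)|² dk⃗ + ∫_{ℝ³} ω(|k⃗|)^{−1}·|h̃(k⃗)|² dk⃗. -/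
open Complex MeasureTheory Filter
open scoped RealInnerProductSpace

noncomputable section

theorem osc_bound (μ : ℝ) (hμ : 0 < μ) (g g' : ℝ → ℝ) (h1 : ∀ s, HasDerivAt g (g' s) s)
    (h2 : ∀ s, HasDerivAt g' (-(μ ^ 2 + 4 * Real.exp s ^ 2) * g s) s) :
    ∃ C : ℝ, 0 < C ∧ ∀ s, (1 + 2 * Real.exp s) * g s ^ 2 ≤ C ∧
      g' s ^ 2 ≤ C * (1 + 2 * Real.exp s) := by
  set E1 : ℝ → ℝ := fun s => g' s ^ 2 + (μ ^ 2 + 4 * Real.exp s ^ 2) * g s ^ 2 with hE1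
  set E2 : ℝ → ℝ := fun s => Real.exp (-s) * ((g' s + g s / 2) ^ 2 +
    (4 * Real.exp s ^ 2 + (1 / 4 + μ ^ 2)) * g s ^ 2) with hE2
  have d1 : ∀ s, HasDerivAt E1 (8 * Real.exp s ^ 2 * g s ^ 2) s := by
    intro s
    have := ((h2 s).pow 2).add ((((((Real.hasDerivAt_exp s).pow 2).const_mul 4)).const_add
      (μ ^ 2)).mul ((h1 s).pow 2))
    refine HasDerivAt.congr_deriv (f := _) this ?_
    simp
    ring
  have d2 : ∀ s, HasDerivAt E2 (Real.exp (-s) * (-(2 * (1 / 4 + μ ^ 2)) * g s ^ 2)) s := by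
    intro s
    have := ((hasDerivAt_neg s).exp).mul ((((h2 s).add ((h1 s).div_const 2)).pow 2).add
      ((((((Real.hasDerivAt_exp s).pow 2).const_mul 4)).add_const
      (1 / 4 + μ ^ 2)).mul ((h1 s).pow 2)))
    refine HasDerivAt.congr_deriv (f := _) this ?_
    simp
    ring
  have m1 : Monotone E1 := monotone_of_hasDerivAt_nonneg d1 (fun s => by
    simp only [Pi.zero_apply]; positivity)
  have m2 : Antitone E2 := antitone_of_hasDerivAt_nonpos d2 (fun s => by
    simp only [Pi.zero_apply]
    have : 0 ≤ Real.exp (-s) * ((2 * (1 / 4 + μ ^ 2)) * g s ^ 2) := by positivity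
    linarith)
  have e1 : 0 ≤ E1 0 := by simp only [hE1]; positivity
  have e2 : 0 ≤ E2 0 := by simp only [hE2]; positivity
  refine ⟨E1 0 + 3 * (E1 0 / μ ^ 2) + 10 * E2 0 + 1, by positivity, fun s => ?_⟩
  have hx := Real.exp_pos s
  rcases le_total s 0 with hs | hs
  · have hE := m1 hs
    have hx1 : Real.exp s ≤ 1 := by simpa using hs
    have k1 : g' s ^ 2 ≤ E1 0 := le_trans (by simp only [hE1]; nlinarith [show 0 ≤ (μ ^ 2 + 4 * Real.exp s ^ 2) * g s ^ 2 by positivity]) hE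
    have k2 : g s ^ 2 ≤ E1 0 / μ ^ 2 := by
      rw [le_div_iff₀ (by positivity)]
      refine le_trans ?_ hE
      simp only [hE1]
      nlinarith [show 0 ≤ Real.exp s ^ 2 * g s ^ 2 by positivity, sq_nonneg (g' s)]
    have : 0 ≤ E1 0 / μ ^ 2 := by positivity
    constructor
    · nlinarith [sq_nonneg (g s)]
    · nlinarith
  · have hE := m2 hs
    have hx1 : 1 ≤ Real.exp s := by simpa using hs
    have hE' : (g' s + g s / 2) ^ 2 +
      (4 * Real.exp s ^ 2 + (1 / 4 + μ ^ 2)) * g s ^ 2 ≤ E2 0 * Real.exp s := by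
      have := mul_le_mul_of_nonneg_right hE hx.le
      refine le_trans (le_of_eq ?_) this
      simp only [hE2]
      have h0 : Real.exp (-s) * Real.exp s = 1 := by rw [← Real.exp_add]; simp
      linear_combination (-((g' s + g s / 2) ^ 2 +
        (4 * Real.exp s ^ 2 + (1 / 4 + μ ^ 2)) * g s ^ 2)) * h0
    have k2 : Real.exp s * g s ^ 2 ≤ E2 0 := by
      have : Real.exp s * (Real.exp s * g s ^ 2) ≤ Real.exp s * E2 0 := by
        nlinarith [sq_nonneg (g' s + g s / 2), show 0 ≤ Real.exp s ^ 2 * g s ^ 2 by positivity,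
          show 0 ≤ (1 / 4 + μ ^ 2) * g s ^ 2 by positivity]
      exact le_of_mul_le_mul_left this hx
    have k1 : g' s ^ 2 ≤ 4 * (E2 0 * Real.exp s) := by
      nlinarith [sq_nonneg (g' s + g s), show 0 ≤ Real.exp s ^ 2 * g s ^ 2 by positivity,
          show 0 ≤ μ ^ 2 * g s ^ 2 by positivity, sq_nonneg (g s), sq_nonneg (g' s)]
    have : 0 ≤ E1 0 / μ ^ 2 := by positivity
    constructor
    · nlinarith [sq_nonneg (g s)]
    · nlinarith [mul_nonneg e1 hx.le, mul_nonneg e2 hx.le, mul_nonneg this hx.le]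
/-- term summability class -/
def Ent (a : ℕ → ℂ) : Prop := ∀ r : ℝ, 0 < r → Summable fun n => ‖a n‖ * r ^ n

theorem Ent.mul {a : ℕ → ℂ} (ha : Ent a) (α : ℂ) : Ent (fun n => (α + 2 * (n : ℂ)) * a n) := by
  intro r hr
  have h := (ha (2 * r) (by positivity)).mul_left (‖α‖ + 2)
  refine Summable.of_nonneg_of_le (fun n => by positivity) (fun n => ?_) h
  have h1 : ‖α + 2 * (n : ℂ)‖ ≤ (‖α‖ + 2) * 2 ^ n := by
    have h2 : ((n : ℝ)) ≤ 2 ^ n := by exact_mod_cast Nat.lt_two_pow_self.le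
    have h3 : (1 : ℝ) ≤ 2 ^ n := one_le_pow₀ (by norm_num)
    calc ‖α + 2 * (n : ℂ)‖ ≤ ‖α‖ + ‖2 * (n : ℂ)‖ := norm_add_le _ _
      _ = ‖α‖ + 2 * n := by simp
      _ ≤ _ := by nlinarith [norm_nonneg α]
  rw [norm_mul, mul_pow]
  calc ‖α + 2 * (n : ℂ)‖ * ‖a n‖ * r ^ n ≤ ((‖α‖ + 2) * 2 ^ n) * ‖a n‖ * r ^ n := by gcongr
    _ = _ := by ring

/-- Exponential series. -/
def serE (α : ℂ) (a : ℕ → ℂ) (s : ℝ) : ℂ := ∑' n : ℕ, a n * Complex.exp ((α + 2 * (n : ℂ)) * (s : ℂ))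

theorem norm_exp_term (α : ℂ) (hα : α.re = 0) (n : ℕ) (s : ℝ) :
    ‖Complex.exp ((α + 2 * (n : ℂ)) * (s : ℂ))‖ = (Real.exp (2 * s)) ^ n := by
  rw [Complex.norm_exp, ← Real.exp_nat_mul]
  congr 1
  simp [hα]
  ring

theorem serE_summable {α : ℂ} (hα : α.re = 0) {a : ℕ → ℂ} (ha : Ent a) (s : ℝ) :
    Summable fun n : ℕ => a n * Complex.exp ((α + 2 * (n : ℂ)) * (s : ℂ)) := by
  refine Summable.of_norm ?_
  simp only [norm_mul, norm_exp_term α hα]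
  exact ha _ (Real.exp_pos _)

theorem serE_deriv {α : ℂ} (hα : α.re = 0) {a : ℕ → ℂ} (ha : Ent a) (s : ℝ) :
    HasDerivAt (serE α a) (serE α (fun n => (α + 2 * (n : ℂ)) * a n) s) s := by
  have hu := (ha.mul α) (Real.exp (2 * (s + 1))) (Real.exp_pos _)
  have hs : s ∈ Set.Iio (s + 1) := by simp
  unfold serE
  refine hasDerivAt_tsum_of_isPreconnected (𝕜 := ℝ) (F := ℂ) (t := Set.Iio (s + 1)) (y₀ := s) (y := s)
    (g := fun n y => a n * Complex.exp ((α + 2 * (n : ℂ)) * (y : ℂ)))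
    (g' := fun n y => (α + 2 * (n : ℂ)) * a n * Complex.exp ((α + 2 * (n : ℂ)) * (y : ℂ)))
    hu isOpen_Iio isPreconnected_Iio ?_ ?_ hs (serE_summable hα ha s) hs
  · intro n y _
    have := (((((hasDerivAt_id y).ofReal_comp).const_mul (α + 2 * (n : ℂ)))).cexp).const_mul (a n)
    refine this.congr_deriv ?_
    simp
    ring
  · intro n y hy
    rw [norm_mul, norm_exp_term α hα]
    gcongr
    exact (Set.mem_Iio.1 hy).le

/-- Bessel coefficients. -/
def bco (α : ℂ) (n : ℕ) : ℂ := (-1 : ℂ) ^ n / ((n.factorial : ℂ) * Complex.Gamma (α + (n : ℂ) + 1))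

theorem bco_succ {α : ℂ} (hα : α.re = 0) (n : ℕ) :
    ((n : ℂ) + 1) * (α + n + 1) * bco α (n + 1) = - bco α n := by
  have h0 : α + n + 1 ≠ 0 := by
    intro h
    have := congrArg Complex.re h
    simp [hα] at this
    have h2 : (0:ℝ) ≤ n := n.cast_nonneg
    linarith
  have hn : (n : ℂ) + 1 ≠ 0 := by exact_mod_cast n.succ_ne_zero
  have hG : Complex.Gamma (α + n + 1) ≠ 0 := by
    apply Complex.Gamma_ne_zero_of_re_pos
    simp [hα]; positivity
  have hf : (n.factorial : ℂ) ≠ 0 := by exact_mod_cast n.factorial_ne_zero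
  unfold bco
  rw [show α + ((n + 1 : ℕ) : ℂ) + 1 = (α + n + 1) + 1 by push_cast; ring,
    Complex.Gamma_add_one _ h0, Nat.factorial_succ]
  push_cast
  field_simp
  ring

theorem bco_ent {α : ℂ} (hα : α.re = 0) : Ent (bco α) := by
  intro r hr
  refine summable_of_ratio_norm_eventually_le (r := 1 / 2) (by norm_num) ?_
  filter_upwards [eventually_ge_atTop ⌈2 * r⌉₊] with n hn
  have hn' : 2 * r ≤ n := (Nat.le_ceil _).trans (by exact_mod_cast hn)
  have h := congrArg norm (bco_succ hα n)
  rw [norm_mul, norm_mul, norm_neg] at h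
  have h1 : ‖(n : ℂ) + 1‖ = n + 1 := by
    rw [show (n : ℂ) + 1 = ((n + 1 : ℕ) : ℂ) by push_cast; rfl, Complex.norm_natCast]; simp
  have h2 : (1 : ℝ) ≤ ‖α + n + 1‖ := by
    refine le_trans ?_ (Complex.re_le_norm _)
    simp [hα]
  have h3 : 2 * r * ‖bco α (n + 1)‖ ≤ ‖bco α n‖ := by
    rw [← h, h1]
    have : 2 * r * 1 ≤ ((n : ℝ) + 1) * ‖α + n + 1‖ := by gcongr; linarith
    nlinarith [norm_nonneg (bco α (n + 1))]
  rw [norm_mul, norm_mul, norm_norm, norm_norm, norm_pow, norm_pow, Real.norm_of_nonneg hr.le, pow_succ]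
  nlinarith [pow_pos hr n]

theorem serE_ode {α : ℂ} (hα : α.re = 0) (s : ℝ) :
    serE α (fun n => (α + 2 * (n : ℂ)) * ((α + 2 * (n : ℂ)) * bco α n)) s =
      (α ^ 2 - 4 * (Real.exp s : ℂ) ^ 2) * serE α (bco α) s := by
  have S := serE_summable hα (bco_ent hα) s
  have S2 := serE_summable hα (((bco_ent hα).mul α).mul α) s
  have key : ∀ n : ℕ, (α + 2 * ((n + 1 : ℕ) : ℂ)) * ((α + 2 * ((n + 1 : ℕ) : ℂ)) * bco α (n + 1)) *
      Complex.exp ((α + 2 * ((n + 1 : ℕ) : ℂ)) * (s : ℂ)) =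
      α ^ 2 * (bco α (n + 1) * Complex.exp ((α + 2 * ((n + 1 : ℕ) : ℂ)) * (s : ℂ))) -
      4 * (Real.exp s : ℂ) ^ 2 * (bco α n * Complex.exp ((α + 2 * (n : ℂ)) * (s : ℂ))) := by
    intro n
    have e : Complex.exp ((α + 2 * ((n + 1 : ℕ) : ℂ)) * (s : ℂ)) =
        (Real.exp s : ℂ) ^ 2 * Complex.exp ((α + 2 * (n : ℂ)) * (s : ℂ)) := by
      rw [Complex.ofReal_exp, ← Complex.exp_nat_mul, ← Complex.exp_add]
      congr 1
      push_cast; ring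
    have hb := bco_succ hα n
    rw [e]
    simp only [Nat.cast_add, Nat.cast_one]
    linear_combination (4 * (Real.exp s : ℂ) ^ 2 * Complex.exp ((α + 2 * (n : ℂ)) * (s : ℂ))) * hb
  have S' := (summable_nat_add_iff 1).2 S
  unfold serE
  rw [S2.tsum_eq_zero_add]
  simp only [key]
  rw [(S'.mul_left (α ^ 2)).tsum_sub (S.mul_left _), tsum_mul_left, tsum_mul_left]
  conv_rhs => rw [sub_mul]
  conv_rhs => enter [1, 2]; rw [S.tsum_eq_zero_add]
  simp
  ring

/-- The Hankel function in logarithmic variable. -/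
def hanG (α : ℂ) (s : ℝ) : ℂ :=
  (serE (-α) (bco (-α)) s - Complex.exp (-(Complex.I * (Real.pi : ℂ) * α)) * serE α (bco α) s) /
    (Complex.I * Complex.sin (α * (Real.pi : ℂ)))

theorem hankel1_eq (α : ℂ) (x : ℝ) : hankel1 α x = hanG α (Real.log (x / 2)) := rfl

theorem hanG_ode (μ : ℝ) : ∃ G' : ℝ → ℂ, (∀ s, HasDerivAt (hanG (Complex.I * μ)) (G' s) s) ∧
    ∀ s, HasDerivAt G' (-((μ : ℂ) ^ 2 + 4 * (Real.exp s : ℂ) ^ 2) * hanG (Complex.I * μ) s) s := by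
  set α := Complex.I * (μ : ℂ) with hα'
  have hα : α.re = 0 := by simp [α]
  have hα2 : (-α).re = 0 := by simp [α]
  have hsq : α ^ 2 = -(μ : ℂ) ^ 2 := by rw [hα', mul_pow, Complex.I_sq]; ring
  refine ⟨_, fun s => ((serE_deriv hα2 (bco_ent hα2) s).sub ((serE_deriv hα (bco_ent hα) s).const_mul
    (Complex.exp (-(Complex.I * (Real.pi : ℂ) * α))))).div_const _, fun s => ?_⟩
  refine (((serE_deriv hα2 ((bco_ent hα2).mul _) s).sub ((serE_deriv hα ((bco_ent hα).mul _) s).const_mul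
    (Complex.exp (-(Complex.I * (Real.pi : ℂ) * α))))).div_const _).congr_deriv ?_
  rw [serE_ode hα, serE_ode hα2, neg_sq, hsq]
  unfold hanG
  ring

theorem hanG_bound (μ : ℝ) (hμ : 0 < μ) : ∃ G' : ℝ → ℂ,
    (∀ s, HasDerivAt (hanG (Complex.I * μ)) (G' s) s) ∧
    ∃ C : ℝ, 0 < C ∧ ∀ s, (1 + 2 * Real.exp s) * ‖hanG (Complex.I * μ) s‖ ^ 2 ≤ C ∧
      ‖G' s‖ ^ 2 ≤ C * (1 + 2 * Real.exp s) := by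
  obtain ⟨G', h1, h2⟩ := hanG_ode μ
  refine ⟨G', h1, ?_⟩
  set G := hanG (Complex.I * μ)
  obtain ⟨A, hA, bA⟩ := osc_bound μ hμ (fun s => (G s).re) (fun s => (G' s).re)
    (fun s => (Complex.reCLM.hasFDerivAt.comp_hasDerivAt s (h1 s)))
    (fun s => (Complex.reCLM.hasFDerivAt.comp_hasDerivAt s (h2 s)).congr_deriv (by
      rw [show -((μ : ℂ) ^ 2 + 4 * (Real.exp s : ℂ) ^ 2) = ((-(μ ^ 2 + 4 * Real.exp s ^ 2) : ℝ) : ℂ) by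
        push_cast; ring]
      exact Complex.re_ofReal_mul _ _))
  obtain ⟨B, hB, bB⟩ := osc_bound μ hμ (fun s => (G s).im) (fun s => (G' s).im)
    (fun s => (Complex.imCLM.hasFDerivAt.comp_hasDerivAt s (h1 s)))
    (fun s => (Complex.imCLM.hasFDerivAt.comp_hasDerivAt s (h2 s)).congr_deriv (by
      rw [show -((μ : ℂ) ^ 2 + 4 * (Real.exp s : ℂ) ^ 2) = ((-(μ ^ 2 + 4 * Real.exp s ^ 2) : ℝ) : ℂ) by
        push_cast; ring]
      exact Complex.im_ofReal_mul _ _))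
  refine ⟨A + B, by positivity, fun s => ?_⟩
  rw [← Complex.normSq_eq_norm_sq, ← Complex.normSq_eq_norm_sq, Complex.normSq_apply,
    Complex.normSq_apply]
  have := bA s
  have := bB s
  constructor <;> nlinarith
theorem omegaK_pos (k : ℝ) : 0 < omegaK k := Real.sqrt_pos.2 (by positivity)

theorem omegaK_le {k : ℝ} (hk : 0 ≤ k) : omegaK k ≤ 1 + k := by
  unfold omegaK
  rw [Real.sqrt_le_left (by positivity)]
  nlinarith

theorem le_omegaK {k : ℝ} (hk : 0 ≤ k) : 1 + k ≤ 2 * omegaK k := by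
  have h1 : (1 + k) / 2 ≤ omegaK k := Real.le_sqrt_of_sq_le (by nlinarith [sq_nonneg (k - 1)])
  linarith

theorem one_le_omegaK (k : ℝ) : 1 ≤ omegaK k :=
  Real.le_sqrt_of_sq_le (by nlinarith [sq_nonneg k])

theorem mode_bound (m R : ℝ) (hmR : 3 / 2 < m * R) : ∃ C : ℝ, 0 < C ∧ ∀ t k : ℝ, 1 ≤ t → 0 < k →
    ‖modeV m R t k‖ ^ 2 * omegaK k ≤ C * t ^ 3 ∧ ‖modeV' m R t k‖ ^ 2 ≤ C * t ^ 2 * omegaK k := by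
  have hμ : 0 < modeMu m R := Real.sqrt_pos.2 (by nlinarith)
  obtain ⟨G', hd, C, hC, hb⟩ := hanG_bound (modeMu m R) hμ
  refine ⟨14 * C, by positivity, fun t k ht hk => ?_⟩
  have ht0 : 0 < t := by linarith
  set G := hanG (Complex.I * (modeMu m R : ℂ)) with hG
  set s := Real.log (k * t / 2) with hs
  obtain ⟨b1, b2⟩ := hb s
  have hes : 2 * Real.exp s = k * t := by rw [hs, Real.exp_log (by positivity)]; ring
  rw [hes] at b1 b2
  set e : ℝ := Real.exp (-(modeMu m R * Real.pi / 2)) with he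
  have he0 : 0 < e := Real.exp_pos _
  have he1 : e ≤ 1 := by
    rw [he, Real.exp_le_one_iff]
    have : 0 < modeMu m R * Real.pi / 2 := by positivity
    linarith
  have hesq : e ^ 2 ≤ 1 := pow_le_one₀ he0.le he1
  have hV : ∀ t, modeV m R t k = (e : ℂ) * ((t ^ ((3 : ℝ) / 2) : ℝ) : ℂ) * G (Real.log (k * t / 2)) :=
    fun t => rfl
  have hlog : HasDerivAt (fun t => Real.log (k * t / 2)) (1 / t) t := by
    have := ((((hasDerivAt_id t).const_mul k).div_const 2)).log
      (by simp only [id]; positivity)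
    refine this.congr_deriv ?_
    simp only [id]
    field_simp
  have hp : HasDerivAt (fun t : ℝ => ((t ^ ((3 : ℝ) / 2) : ℝ) : ℂ))
      (((3 / 2 * t ^ ((1 : ℝ) / 2) : ℝ)) : ℂ) t := by
    have := (Real.hasDerivAt_rpow_const (x := t) (p := 3 / 2) (Or.inl ht0.ne')).ofReal_comp
    refine this.congr_deriv ?_
    norm_num
  have hsqrt : t ^ ((3 : ℝ) / 2) = t * t ^ ((1 : ℝ) / 2) := by
    rw [show (3 : ℝ) / 2 = 1 + 1 / 2 by norm_num, Real.rpow_add ht0, Real.rpow_one]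
  have hV' : modeV' m R t k = (e : ℂ) * ((t ^ ((1 : ℝ) / 2) : ℝ) : ℂ) * (3 / 2 * G s + G' s) := by
    have hc : HasDerivAt (fun t => G (Real.log (k * t / 2))) ((1 / t) • G' s) t :=
      HasDerivAt.scomp (g₁ := G) (h := fun t => Real.log (k * t / 2)) t (hd s) hlog
    have := ((hp.const_mul (e : ℂ)).mul hc).deriv
    unfold modeV'
    refine Eq.trans this ?_
    have ht' : (t : ℂ) ≠ 0 := by exact_mod_cast ht0.ne'
    rw [hsqrt, Complex.real_smul]
    push_cast
    rw [← hs]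
    field_simp
  have hh : (t ^ ((1 : ℝ) / 2)) ^ 2 = t := by
    rw [← Real.rpow_natCast, ← Real.rpow_mul ht0.le]; norm_num
  have hω := omegaK_pos k
  have hω1 := omegaK_le hk.le
  have hω2 := le_omegaK hk.le
  have hkt : k ≤ k * t := by nlinarith
  have hGω : ‖G s‖ ^ 2 * omegaK k ≤ C := by
    refine le_trans ?_ b1
    nlinarith [sq_nonneg ‖G s‖]
  constructor
  · rw [hV, hsqrt]
    rw [norm_mul, norm_mul, Complex.norm_real, Complex.norm_real, Real.norm_of_nonneg he0.le,
      Real.norm_of_nonneg (by positivity), mul_pow, mul_pow, mul_pow, hh]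
    calc e ^ 2 * (t ^ 2 * t) * ‖G s‖ ^ 2 * omegaK k = e ^ 2 * t ^ 3 * (‖G s‖ ^ 2 * omegaK k) := by ring
      _ ≤ 1 * t ^ 3 * C := by gcongr
      _ ≤ _ := by nlinarith [show 0 ≤ t ^ 3 * C by positivity]
  · rw [hV']
    rw [norm_mul, norm_mul, Complex.norm_real, Complex.norm_real, Real.norm_of_nonneg he0.le,
      Real.norm_of_nonneg (by positivity), mul_pow, mul_pow, hh]
    have hn : ‖3 / 2 * G s + G' s‖ ≤ 3 / 2 * ‖G s‖ + ‖G' s‖ := by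
      refine (norm_add_le _ _).trans ?_
      rw [norm_mul]
      norm_num
    have hg : ‖G s‖ ^ 2 ≤ C := by nlinarith [sq_nonneg ‖G s‖, show 0 ≤ k * t * ‖G s‖ ^ 2 by positivity]
    have h7 : ‖3 / 2 * G s + G' s‖ ^ 2 ≤ 7 * C * (1 + k * t) := by
      have : ‖3 / 2 * G s + G' s‖ ^ 2 ≤ (3 / 2 * ‖G s‖ + ‖G' s‖) ^ 2 := by gcongr
      nlinarith [sq_nonneg (3 / 2 * ‖G s‖ - ‖G' s‖), show 0 ≤ C * (k * t) by positivity]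
    have h8 : 1 + k * t ≤ t * (2 * omegaK k) := by nlinarith
    calc e ^ 2 * t * ‖3 / 2 * G s + G' s‖ ^ 2 ≤ 1 * t * (7 * C * (t * (2 * omegaK k))) := by
          gcongr
          exact h7.trans (by gcongr)
      _ = _ := by ring

/-- The Fourier transform of a real Schwartz function is Schwartz. -/
theorem ft_schwartz (f : SchwartzMap V3 ℝ) : ∃ S : SchwartzMap V3 ℂ,
    ft (fun x => (f x : ℂ)) = ⇑S := by
  have h2 : (2 * Real.pi)⁻¹ ≠ 0 := by positivity
  let fc : SchwartzMap V3 ℂ := f.postcompCLM (𝕜 := ℝ) Complex.ofRealCLM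
  let S0 : SchwartzMap V3 ℂ := FourierTransform.fourier fc
  let E : V3 ≃L[ℝ] V3 := ContinuousLinearEquiv.smulLeft (Units.mk0 _ h2)
  refine ⟨(((2 * Real.pi) ^ (-(3 : ℝ) / 2) : ℝ) : ℂ) •
    SchwartzMap.compCLMOfContinuousLinearEquiv ℂ E S0, ?_⟩
  funext k
  have hS : S0 ((2 * Real.pi)⁻¹ • k) = ∫ x : V3, Complex.exp (-(Complex.I) * (⟪k, x⟫ : ℂ)) * (f x : ℂ) := by
    have := Real.fourier_eq' (⇑fc) ((2 * Real.pi)⁻¹ • k)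
    refine Eq.trans (show _ = FourierTransform.fourier (⇑fc) ((2 * Real.pi)⁻¹ • k) by
      rw [← SchwartzMap.fourier_coe]) (this.trans ?_)
    refine integral_congr_ae (Eventually.of_forall fun x => ?_)
    have hfc : fc x = (f x : ℂ) := rfl
    simp only [hfc, smul_eq_mul]
    congr 2
    rw [inner_smul_right, real_inner_comm]
    have hpi : (Real.pi : ℂ) ≠ 0 := by exact_mod_cast Real.pi_ne_zero
    push_cast
    field_simp
  unfold ft
  rw [← hS]
  rfl

theorem weight_integrable (S : SchwartzMap V3 ℂ) (w : V3 → ℝ) (hw : Continuous w)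
    (hw0 : ∀ k, 0 ≤ w k) (hw1 : ∀ k, w k ≤ 1 + ‖k‖) :
    Integrable (fun k : V3 => w k * ‖S k‖ ^ 2) := by
  obtain ⟨B, hB⟩ := S.decay 0 0
  obtain ⟨D, hD⟩ := S.decay 1 0
  have hi := (S.integrable (μ := volume)).norm.const_mul (B + D)
  refine hi.mono' (by
    have := S.continuous
    exact (by fun_prop : Continuous fun k : V3 => w k * ‖S k‖ ^ 2).aestronglyMeasurable) ?_
  refine Eventually.of_forall fun k => ?_
  have h1 := hB.2 k
  have h2 := hD.2 k
  simp only [norm_iteratedFDeriv_zero, pow_zero, one_mul, pow_one] at h1 h2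
  rw [Real.norm_of_nonneg (mul_nonneg (hw0 k) (by positivity))]
  calc w k * ‖S k‖ ^ 2 ≤ (1 + ‖k‖) * ‖S k‖ ^ 2 := by gcongr; exact hw1 k
    _ = (‖S k‖ + ‖k‖ * ‖S k‖) * ‖S k‖ := by ring
    _ ≤ _ := by gcongr

theorem omegaK_cont : Continuous fun k : V3 => omegaK ‖k‖ := by
  unfold omegaK
  fun_prop

/-- `‖K_t(f,h)‖_{L²} ≤ C·t·‖(f,h)‖_{1/2}` for all `t ≥ 1` and Schwartz `f, h`. -/
theorem kt_bound (m R : ℝ) (hm : 0 < m) (hR : 0 < R) (hmR : 3 / 2 < m * R) :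
    ∃ C : ℝ, 0 < C ∧ ∀ t : ℝ, 1 ≤ t → ∀ f h : SchwartzMap V3 ℝ,
      l2Norm (ktFun m R t ⇑f ⇑h) ≤
        C * t * halfNorm (ft fun x => (f x : ℂ)) (ft fun x => (h x : ℂ)) := by
  obtain ⟨C, hC, hb⟩ := mode_bound m R hmR
  set D : ℝ := 2 * (Real.pi / 4) ^ 2 * C * (1 + R ^ 2) with hD
  have hD0 : 0 < D := by positivity
  refine ⟨Real.sqrt D, Real.sqrt_pos.2 hD0, fun t ht f h => ?_⟩
  obtain ⟨F, hF⟩ := ft_schwartz f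
  obtain ⟨H, hH⟩ := ft_schwartz h
  unfold ktFun
  rw [hF, hH]
  have ht0 : 0 < t := by linarith
  have iF : Integrable (fun k : V3 => omegaK ‖k‖ * ‖F k‖ ^ 2) :=
    weight_integrable F _ omegaK_cont (fun k => (omegaK_pos _).le)
      (fun k => omegaK_le (norm_nonneg k))
  have iH : Integrable (fun k : V3 => (omegaK ‖k‖)⁻¹ * ‖H k‖ ^ 2) :=
    weight_integrable H _ (omegaK_cont.inv₀ fun k => (omegaK_pos _).ne')
      (fun k => (inv_pos.2 (omegaK_pos _)).le)
      (fun k => (inv_le_one_of_one_le₀ (one_le_omegaK _)).trans (by simp))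
  have hpt : ∀ k : V3, k ≠ 0 → ‖ktAux m R t F H k‖ ^ 2 ≤
      D * (omegaK ‖k‖ * ‖F k‖ ^ 2 + (omegaK ‖k‖)⁻¹ * ‖H k‖ ^ 2) := by
    intro k hk
    obtain ⟨b1, b2⟩ := hb t ‖k‖ ht (norm_pos_iff.2 hk)
    have hω := omegaK_pos ‖k‖
    set w := omegaK ‖k‖
    set v := ‖modeV m R t ‖k‖‖ with hv
    set v' := ‖modeV' m R t ‖k‖‖ with hv'
    have b1' : v ^ 2 ≤ C * t ^ 3 * w⁻¹ := by
      rw [← div_eq_mul_inv, le_div_iff₀ hω]; exact b1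
    have hn : ‖ktAux m R t F H k‖ ≤ (Real.pi / 4) * (t ^ 3)⁻¹ * (t * ‖F k‖ * v' + R * ‖H k‖ * v) := by
      unfold ktAux
      rw [norm_mul]
      gcongr
      · rw [norm_div, norm_mul, norm_mul, norm_pow, Complex.norm_real, Complex.norm_real,
          Complex.norm_I, Real.norm_of_nonneg Real.pi_pos.le, Real.norm_of_nonneg ht0.le]
        norm_num
        apply le_of_eq
        field_simp
      · refine (norm_sub_le _ _).trans ?_
        simp only [norm_mul, RCLike.norm_conj, Complex.norm_real, Real.norm_of_nonneg ht0.le,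
          Real.norm_of_nonneg hR.le]
        exact le_rfl
    have ht1 : 1 ≤ t ^ 2 := one_le_pow₀ ht
    have ht2 : 1 ≤ t ^ 3 := one_le_pow₀ ht
    calc ‖ktAux m R t F H k‖ ^ 2
        ≤ ((Real.pi / 4) * (t ^ 3)⁻¹ * (t * ‖F k‖ * v' + R * ‖H k‖ * v)) ^ 2 := by gcongr
      _ = (Real.pi / 4) ^ 2 * (t ^ 6)⁻¹ * (t * ‖F k‖ * v' + R * ‖H k‖ * v) ^ 2 := by
          rw [mul_pow, mul_pow, inv_pow]; ring_nf
      _ ≤ (Real.pi / 4) ^ 2 * (t ^ 6)⁻¹ * (2 * (t ^ 2 * ‖F k‖ ^ 2 * v' ^ 2 + R ^ 2 * ‖H k‖ ^ 2 * v ^ 2)) := by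
          gcongr
          nlinarith [sq_nonneg (t * ‖F k‖ * v' - R * ‖H k‖ * v)]
      _ ≤ (Real.pi / 4) ^ 2 * (t ^ 6)⁻¹ * (2 * (t ^ 2 * ‖F k‖ ^ 2 * (C * t ^ 2 * w) +
            R ^ 2 * ‖H k‖ ^ 2 * (C * t ^ 3 * w⁻¹))) := by
          gcongr
      _ = 2 * (Real.pi / 4) ^ 2 * C * ((t ^ 2)⁻¹ * (w * ‖F k‖ ^ 2) +
            (t ^ 3)⁻¹ * (R ^ 2 * (w⁻¹ * ‖H k‖ ^ 2))) := by
          field_simp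
      _ ≤ 2 * (Real.pi / 4) ^ 2 * C * (1 * (w * ‖F k‖ ^ 2) + 1 * (R ^ 2 * (w⁻¹ * ‖H k‖ ^ 2))) := by
          gcongr
          · exact inv_le_one_of_one_le₀ ht1
          · exact inv_le_one_of_one_le₀ ht2
      _ ≤ 2 * (Real.pi / 4) ^ 2 * C * ((1 + R ^ 2) * (w * ‖F k‖ ^ 2 + w⁻¹ * ‖H k‖ ^ 2)) := by
          gcongr
          have : 0 ≤ R ^ 2 * (w * ‖F k‖ ^ 2) := by positivity
          have : 0 ≤ w⁻¹ * ‖H k‖ ^ 2 := by positivity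
          linarith
      _ = _ := by rw [hD]; ring
  have hae : ∀ᵐ k : V3, k ≠ 0 := by
    have : (volume : Measure V3) {0} = 0 := measure_singleton _
    exact compl_mem_ae_iff.2 this
  have hint : ∫ k : V3, ‖ktAux m R t F H k‖ ^ 2 ≤ D * halfNormSq F H := by
    unfold halfNormSq
    rw [← integral_add iF iH, ← integral_const_mul]
    refine integral_mono_of_nonneg (Eventually.of_forall fun k => by positivity)
      ((iF.add iH).const_mul D) ?_
    filter_upwards [hae] with k hk using hpt k hk
  unfold l2Norm halfNorm
  calc Real.sqrt (∫ k : V3, ‖ktAux m R t F H k‖ ^ 2) ≤ Real.sqrt (D * halfNormSq F H) :=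
        Real.sqrt_le_sqrt hint
    _ = Real.sqrt D * 1 * Real.sqrt (halfNormSq F H) := by rw [Real.sqrt_mul hD0.le, mul_one]
    _ ≤ _ := by gcongr
end
end
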